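/- Let s ∈ (0,1), a = 1 − 2s, and let f : ℝ → ℝ be of class C^{1,γ} for some γ > max(0, 1−2s). Let u be a layer solution of the extension problem in the half-plane ℝ × (0,∞). Then for every x ∈ ℝ the integral ∫₀^∞ t^a |∇u(x,t)|² dt is finite, and the Hamiltonian equality (1+a) ∫₀^∞ (1/2) t^a ( (∂ₓu(x,t))² − (∂_y u(x,t))² ) dt = G(u(x,0)) − G(1) holds for every x ∈ ℝ. -/

import Mathlib

open Real MeasureTheory Filter Set

/-- Normalizing constant of the one-dimensional fractional Laplacian. -/
noncomputable def fracLapCoef (s : ℝ) : ℝ :=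
  (4:ℝ) ^ s * s * Real.Gamma (s + 1/2) / (Real.sqrt π * Real.Gamma (1 - s))

/-- The one-dimensional fractional Laplacian `(-∂ₓₓ)^s v (x)`. -/
noncomputable def fracLap (s : ℝ) (v : ℝ → ℝ) (x : ℝ) : ℝ :=
  fracLapCoef s * ∫ y in Set.Ioi (0:ℝ), (2 * v x - v (x + y) - v (x - y)) * y ^ (-1 - 2*s)

/-- `f` is of class `C^{1,γ}`: continuously differentiable with `γ`-Hölder derivative. -/
def IsC1Holder (γ : ℝ) (f : ℝ → ℝ) : Prop :=
  ContDiff ℝ 1 f ∧ ∃ C : ℝ, ∀ x y : ℝ, |deriv f x - deriv f y| ≤ C * |x - y| ^ γ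

/-- A layer solution of `(-∂ₓₓ)^s v = f(v)` in `ℝ`. -/
structure IsLayerSolution (s : ℝ) (f : ℝ → ℝ) (v : ℝ → ℝ) : Prop where
  bounded : ∃ M : ℝ, ∀ x, |v x| ≤ M
  smooth : ContDiff ℝ 2 v
  eqn : ∀ x, fracLap s v x = f (v x)
  mono : ∀ x, 0 < deriv v x
  limNeg : Tendsto v atBot (nhds (-1))
  limPos : Tendsto v atTop (nhds 1)

/-- The potential `G(r) = -∫₀^r f`. -/
noncomputable def potG (f : ℝ → ℝ) (r : ℝ) : ℝ := -∫ u in (0:ℝ)..r, f u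
/-- A bounded solution of the extension problem in the half-plane `ℝ × (0,∞)`.
`u x y` denotes the value of the solution at `(x,y)`. -/
structure IsBoundedExtSolution1 (a : ℝ) (f : ℝ → ℝ) (u : ℝ → ℝ → ℝ) : Prop where
  bounded : ∃ M : ℝ, ∀ x y : ℝ, 0 ≤ y → |u x y| ≤ M
  cont : ContinuousOn (fun p : ℝ × ℝ => u p.1 p.2) {p : ℝ × ℝ | 0 ≤ p.2}
  smooth : ContDiffOn ℝ 2 (fun p : ℝ × ℝ => u p.1 p.2) {p : ℝ × ℝ | 0 < p.2}
  contDx : ContinuousOn (fun p : ℝ × ℝ => deriv (fun x' => u x' p.2) p.1) {p : ℝ × ℝ | 0 ≤ p.2}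
  eqn : ∀ x y : ℝ, 0 < y →
    y * (deriv (fun r => deriv (fun r' => u r' y) r) x
         + deriv (fun r => deriv (fun r' => u x r') r) y)
      + a * deriv (fun r => u x r) y = 0
  neumann : ∀ x : ℝ, Filter.Tendsto (fun y => -((1+a) * y ^ a * deriv (fun r => u x r) y))
      (nhdsWithin 0 (Set.Ioi 0)) (nhds (f (u x 0)))

/-- A layer solution of the extension problem in the half-plane. -/
structure IsLayerExtSolution1 (a : ℝ) (f : ℝ → ℝ) (u : ℝ → ℝ → ℝ)
    extends IsBoundedExtSolution1 a f u : Prop where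
  mono : ∀ x : ℝ, 0 < deriv (fun x' => u x' 0) x
  limNeg : Filter.Tendsto (fun x => u x 0) Filter.atBot (nhds (-1))
  limPos : Filter.Tendsto (fun x => u x 0) Filter.atTop (nhds 1)

open Real MeasureTheory Filter Set

/-- Classical subsolution of `y (φ_xx + φ_yy) + b φ_y = 0` on `S`, with pure derivatives only. -/
def PSub (b : ℝ) (S : Set (ℝ × ℝ)) (φ : ℝ → ℝ → ℝ) : Prop :=
  ∃ φx φxx φy φyy : ℝ → ℝ → ℝ, ∀ x y, (x, y) ∈ S →
    HasDerivAt (fun r => φ r y) (φx x y) x ∧ HasDerivAt (fun r => φx r y) (φxx x y) x ∧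
    HasDerivAt (fun r => φ x r) (φy x y) y ∧ HasDerivAt (fun r => φy x r) (φyy x y) y ∧
    0 ≤ y * (φxx x y + φyy x y) + b * φy x y

/-- The open upper half plane. -/
def UH : Set (ℝ × ℝ) := {p | 0 < p.2}

lemma PSub.mono {b : ℝ} {S T : Set (ℝ × ℝ)} {φ : ℝ → ℝ → ℝ} (h : PSub b T φ) (hST : S ⊆ T) :
    PSub b S φ := by
  obtain ⟨p, q, r, t, h⟩ := h
  exact ⟨p, q, r, t, fun x y hxy => h x y (hST hxy)⟩

lemma PSub.add {b : ℝ} {S : Set (ℝ × ℝ)} {φ ψ : ℝ → ℝ → ℝ} (h : PSub b S φ) (k : PSub b S ψ) :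
    PSub b S (fun x y => φ x y + ψ x y) := by
  obtain ⟨p, q, r, t, h⟩ := h
  obtain ⟨p', q', r', t', k⟩ := k
  refine ⟨fun x y => p x y + p' x y, fun x y => q x y + q' x y, fun x y => r x y + r' x y,
    fun x y => t x y + t' x y, fun x y hxy => ?_⟩
  obtain ⟨h1, h2, h3, h4, h5⟩ := h x y hxy
  obtain ⟨k1, k2, k3, k4, k5⟩ := k x y hxy
  exact ⟨h1.add k1, h2.add k2, h3.add k3, h4.add k4, by dsimp only; linarith⟩

lemma PSub.smul {b c : ℝ} (hc : 0 ≤ c) {S : Set (ℝ × ℝ)} {φ : ℝ → ℝ → ℝ} (h : PSub b S φ) :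
    PSub b S (fun x y => c * φ x y) := by
  obtain ⟨p, q, r, t, h⟩ := h
  refine ⟨fun x y => c * p x y, fun x y => c * q x y, fun x y => c * r x y,
    fun x y => c * t x y, fun x y hxy => ?_⟩
  obtain ⟨h1, h2, h3, h4, h5⟩ := h x y hxy
  exact ⟨h1.const_mul c, h2.const_mul c, h3.const_mul c, h4.const_mul c, by
    have := mul_nonneg hc h5
    dsimp only; linarith⟩

lemma PSub.comp {b c σ ρ : ℝ} (hρ : 0 < ρ) (hσ : σ ^ 2 = ρ ^ 2) {S T : Set (ℝ × ℝ)}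
    {φ : ℝ → ℝ → ℝ} (h : PSub b T φ) (hST : ∀ x y, (x, y) ∈ S → (c + σ * x, ρ * y) ∈ T) :
    PSub b S (fun x y => φ (c + σ * x) (ρ * y)) := by
  obtain ⟨p, q, r, t, h⟩ := h
  refine ⟨fun x y => p (c + σ * x) (ρ * y) * σ, fun x y => q (c + σ * x) (ρ * y) * σ * σ,
    fun x y => r (c + σ * x) (ρ * y) * ρ,
    fun x y => t (c + σ * x) (ρ * y) * ρ * ρ, fun x y hxy => ?_⟩
  obtain ⟨h1, h2, h3, h4, h5⟩ := h _ _ (hST x y hxy)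
  have e1 : HasDerivAt (fun x : ℝ => c + σ * x) σ x := by
    simpa using ((hasDerivAt_id x).const_mul σ).const_add c
  have e2 : HasDerivAt (fun y : ℝ => ρ * y) ρ y := by
    simpa using ((hasDerivAt_id y).const_mul ρ)
  have c1 := HasDerivAt.comp x h1 e1
  have c2 := (HasDerivAt.comp x h2 e1).mul_const σ
  have c3 := HasDerivAt.comp y h3 e2
  have c4 := (HasDerivAt.comp y h4 e2).mul_const ρ
  refine ⟨c1, c2, c3, c4, ?_⟩
  have := mul_nonneg hρ.le h5
  have e : y * (q (c + σ * x) (ρ * y) * σ * σ + t (c + σ * x) (ρ * y) * ρ * ρ)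
      + b * (r (c + σ * x) (ρ * y) * ρ) = ρ * (ρ * y * (q (c + σ * x) (ρ * y) + t (c + σ * x) (ρ * y)) + b * r (c + σ * x) (ρ * y)) := by
    linear_combination y * q (c + σ * x) (ρ * y) * hσ
  dsimp only
  rw [e]; exact this

lemma second_deriv_nonpos {g g' : ℝ → ℝ} {d x : ℝ} (hmax : IsLocalMax g x)
    (h1 : ∀ᶠ z in nhds x, HasDerivAt g (g' z) z) (h2 : HasDerivAt g' d x) : d ≤ 0 := by
  by_contra hd
  push Not at hd
  have hg0 : g' x = 0 := hmax.hasDerivAt_eq_zero h1.self_of_nhds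
  have e : deriv g =ᶠ[nhds x] g' := h1.mono fun z hz => hz.deriv
  have hdd : deriv (deriv g) x = d := by rw [e.deriv_eq]; exact h2.deriv
  have hmin : IsLocalMin g x := isLocalMin_of_deriv_deriv_pos (by rw [hdd]; exact hd)
    (by rw [h1.self_of_nhds.deriv, hg0]) h1.self_of_nhds.continuousAt
  have hc : g =ᶠ[nhds x] fun _ => g x := by
    filter_upwards [hmin, hmax] with z h3 h4
    exact le_antisymm h4 h3
  have : deriv g =ᶠ[nhds x] deriv (fun _ => g x) := hc.deriv
  have h5 := this.deriv_eq
  rw [hdd] at h5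
  simp at h5
  linarith

lemma maxp {b x1 x2 y1 y2 : ℝ} (hy1 : 0 ≤ y1) {φ : ℝ → ℝ → ℝ}
    (hS : PSub b (Ioo x1 x2 ×ˢ Ioo y1 y2) φ)
    (hc : ContinuousOn (fun p : ℝ × ℝ => φ p.1 p.2) (Icc x1 x2 ×ˢ Icc y1 y2))
    (hbd : ∀ x ∈ Icc x1 x2, ∀ y ∈ Icc y1 y2, (x = x1 ∨ x = x2 ∨ y = y1 ∨ y = y2) → φ x y ≤ 0) :
    ∀ x ∈ Icc x1 x2, ∀ y ∈ Icc y1 y2, φ x y ≤ 0 := by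
  intro x hx y hy
  by_contra hpos
  push Not at hpos
  obtain ⟨ε, hε, hεm⟩ : ∃ ε : ℝ, 0 < ε ∧ ε * (x2 - x1) ^ 2 < φ x y := by
    refine ⟨φ x y / (2 * ((x2 - x1) ^ 2 + 1)), by positivity, ?_⟩
    have : 0 ≤ (x2 - x1) ^ 2 := sq_nonneg _
    rw [div_mul_eq_mul_div, div_lt_iff₀ (by positivity)]
    nlinarith
  have hK : IsCompact (Icc x1 x2 ×ˢ Icc y1 y2) := isCompact_Icc.prod isCompact_Icc
  have hc' : ContinuousOn (fun p : ℝ × ℝ => φ p.1 p.2 + ε * (p.1 - x1) ^ 2)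
      (Icc x1 x2 ×ˢ Icc y1 y2) := hc.add (by fun_prop)
  obtain ⟨⟨X, Y⟩, hp, hmax⟩ := hK.exists_isMaxOn ⟨(x, y), ⟨hx, hy⟩⟩ hc'
  have hval : φ x y ≤ φ X Y + ε * (X - x1) ^ 2 := by
    have := hmax (show (x, y) ∈ Icc x1 x2 ×ˢ Icc y1 y2 from ⟨hx, hy⟩)
    simp only [mem_ofPred_eq] at this
    nlinarith [mul_nonneg hε.le (sq_nonneg (x - x1))]
  obtain ⟨hX, hY⟩ := hp
  simp only at hX hY
  have hsq : (X - x1) ^ 2 ≤ (x2 - x1) ^ 2 := by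
    have := hX.1; have := hX.2
    apply pow_le_pow_left₀ <;> linarith
  have hφpos : 0 < φ X Y := by nlinarith
  have hnb : ¬ (X = x1 ∨ X = x2 ∨ Y = y1 ∨ Y = y2) := fun h => by
    have := hbd X hX Y hY h
    linarith
  push Not at hnb
  obtain ⟨n1, n2, n3, n4⟩ := hnb
  have hXo : X ∈ Ioo x1 x2 := ⟨lt_of_le_of_ne hX.1 (Ne.symm n1), lt_of_le_of_ne hX.2 n2⟩
  have hYo : Y ∈ Ioo y1 y2 := ⟨lt_of_le_of_ne hY.1 (Ne.symm n3), lt_of_le_of_ne hY.2 n4⟩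
  obtain ⟨p, q, r, t, h⟩ := hS
  have hxn : ∀ᶠ z in nhds X, z ∈ Ioo x1 x2 := isOpen_Ioo.mem_nhds hXo
  have hyn : ∀ᶠ z in nhds Y, z ∈ Ioo y1 y2 := isOpen_Ioo.mem_nhds hYo
  obtain ⟨h1, h2, h3, h4, h5⟩ := h X Y ⟨hXo, hYo⟩
  -- x direction
  have hx2 : q X Y + 2 * ε ≤ 0 := by
    have hm : IsLocalMax (fun z => φ z Y + ε * (z - x1) ^ 2) X := by
      filter_upwards [hxn] with z hz
      exact hmax (show (z, Y) ∈ Icc x1 x2 ×ˢ Icc y1 y2 from ⟨Ioo_subset_Icc_self hz, hY⟩)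
    refine second_deriv_nonpos (g' := fun z => p z Y + ε * (2 * (z - x1))) hm ?_ ?_
    · filter_upwards [hxn] with z hz
      have := (h z Y ⟨hz, hYo⟩).1
      refine this.add (HasDerivAt.const_mul ε ?_)
      simpa using ((hasDerivAt_id z).sub_const x1).fun_pow 2
    · refine h2.add ?_
      have := (((hasDerivAt_id X).sub_const x1).const_mul 2).const_mul ε
      simpa [mul_comm] using this
  have hm : IsLocalMax (fun z => φ X z) Y := by
    filter_upwards [hyn] with z hz
    have := hmax (show (X, z) ∈ Icc x1 x2 ×ˢ Icc y1 y2 from ⟨hX, Ioo_subset_Icc_self hz⟩)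
    simp only [mem_ofPred_eq] at this
    linarith
  have hy0 : r X Y = 0 := hm.hasDerivAt_eq_zero h3
  have hy2 : t X Y ≤ 0 := by
    refine second_deriv_nonpos (g' := fun z => r X z) hm ?_ h4
    filter_upwards [hyn] with z hz using (h X z ⟨hXo, hz⟩).2.2.1
  have hYpos : 0 < Y := lt_of_le_of_lt hy1 hYo.1
  rw [hy0] at h5
  nlinarith

open Real MeasureTheory Filter Set

lemma psub_rpow (b c : ℝ) : PSub b UH (fun _ y => c * y ^ (1 - b)) := by
  refine ⟨fun _ _ => 0, fun _ _ => 0, fun _ y => c * ((1 - b) * y ^ (1 - b - 1)),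
    fun _ y => c * ((1 - b) * ((1 - b - 1) * y ^ (1 - b - 1 - 1))), fun x y hy => ?_⟩
  have hy : 0 < y := hy
  refine ⟨hasDerivAt_const _ _, hasDerivAt_const _ _,
    (Real.hasDerivAt_rpow_const (Or.inl hy.ne')).const_mul c,
    ((Real.hasDerivAt_rpow_const (Or.inl hy.ne')).const_mul _).const_mul c, ?_⟩
  have e : y ^ (1 - b - 1) = y ^ (1 - b - 1 - 1) * y := by
    rw [← Real.rpow_add_one hy.ne']; ring_nf
  dsimp only
  rw [e]
  apply le_of_eq
  ring

lemma psub_quad (b A m κ x0 : ℝ) (hb : 1 + b ≠ 0) :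
    PSub b UH (fun x y => A + m * (x - x0) + κ * ((x - x0) ^ 2 - y ^ 2 / (1 + b))) := by
  refine ⟨fun x _ => m + κ * (2 * (x - x0)), fun _ _ => κ * 2, fun _ y => κ * (-(2 * y / (1 + b))),
    fun _ y => κ * (-(2 / (1 + b))), fun x y hy => ⟨?_, ?_, ?_, ?_, ?_⟩⟩
  · have h := (hasDerivAt_id x).sub_const x0
    have := ((h.const_mul m).const_add A).fun_add (((h.fun_pow 2).sub_const (y ^ 2 / (1 + b))).const_mul κ)
    simpa using this
  · have h := (hasDerivAt_id x).sub_const x0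
    have := ((h.const_mul 2).const_mul κ).const_add m
    simpa using this
  · have h := (hasDerivAt_id y)
    have := (((((h.fun_pow 2).div_const (1 + b)).const_sub ((x - x0) ^ 2)).const_mul κ)).const_add (A + m * (x - x0))
    simpa using this
  · have h := (hasDerivAt_id y)
    have := (((h.const_mul 2).div_const (1 + b)).neg).const_mul κ
    simpa using this
  · apply le_of_eq
    field_simp
    ring

lemma psub_quart (b c : ℝ) (hb : 1 + b ≠ 0) (hb3 : 6 + 2 * b ≠ 0) :
    PSub b UH (fun x y => c * (x ^ 4 + (-6 / (1 + b)) * x ^ 2 * y ^ 2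
      + (6 / ((1 + b) * (6 + 2 * b))) * y ^ 4)) := by
  refine ⟨fun x y => c * (4 * x ^ 3 + (-6 / (1 + b)) * (2 * x) * y ^ 2),
    fun x y => c * (12 * x ^ 2 + (-6 / (1 + b)) * 2 * y ^ 2),
    fun x y => c * ((-6 / (1 + b)) * x ^ 2 * (2 * y) + (6 / ((1 + b) * (6 + 2 * b))) * (4 * y ^ 3)),
    fun x y => c * ((-6 / (1 + b)) * x ^ 2 * 2 + (6 / ((1 + b) * (6 + 2 * b))) * (12 * y ^ 2)),
    fun x y hy => ⟨?_, ?_, ?_, ?_, ?_⟩⟩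
  · refine HasDerivAt.const_mul c ?_
    have := (((hasDerivAt_id x).fun_pow 4).add ((((hasDerivAt_id x).fun_pow 2).const_mul (-6 / (1 + b))).mul_const (y ^ 2))).add_const ((6 / ((1 + b) * (6 + 2 * b))) * y ^ 4)
    simpa using this
  · refine HasDerivAt.const_mul c ?_
    have := (((hasDerivAt_id x).fun_pow 3).const_mul 4).add ((((hasDerivAt_id x).const_mul 2).const_mul (-6 / (1 + b))).mul_const (y ^ 2))
    refine (this.congr_deriv ?_)
    simp
    ring
  · refine HasDerivAt.const_mul c ?_
    have := ((((hasDerivAt_id y).fun_pow 2).const_mul ((-6 / (1 + b)) * x ^ 2)).const_add (x ^ 4)).fun_add (((hasDerivAt_id y).fun_pow 4).const_mul (6 / ((1 + b) * (6 + 2 * b))))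
    simpa using this
  · refine HasDerivAt.const_mul c ?_
    have := (((hasDerivAt_id y).const_mul 2).const_mul ((-6 / (1 + b)) * x ^ 2)).add ((((hasDerivAt_id y).fun_pow 3).const_mul 4).const_mul (6 / ((1 + b) * (6 + 2 * b))))
    refine (this.congr_deriv ?_)
    simp only [id, mul_one]
    push_cast
    ring
  · apply le_of_eq
    have h3 : 3 + b ≠ 0 := fun h => hb3 (by linarith)
    have e : 6 + 2 * b = 2 * (3 + b) := by ring
    rw [e]
    field_simp
    ring

/-- Unit box boundary estimate. -/
lemma box_unit {b : ℝ} (hb : -3 < b) (hb1 : b < 1) (hbne : b ≠ -1) :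
    ∃ C : ℝ, 0 ≤ C ∧ ∀ (φ : ℝ → ℝ → ℝ) (M : ℝ), 0 ≤ M →
      PSub b (Ioo (-1) 1 ×ˢ Ioo 0 1) φ →
      ContinuousOn (fun p : ℝ × ℝ => φ p.1 p.2) (Icc (-1) 1 ×ˢ Icc 0 1) →
      (∀ x ∈ Icc (-1:ℝ) 1, ∀ y ∈ Icc (0:ℝ) 1, φ x y ≤ M) →
      (∀ x ∈ Icc (-1:ℝ) 1, φ x 0 ≤ 0) →
      ∀ y ∈ Icc (0:ℝ) 1, φ 0 y ≤ M * (C * y ^ (1 - b)) := by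
  have hb1' : 1 + b ≠ 0 := fun h => hbne (by linarith)
  have hb3' : 0 < 6 + 2 * b := by linarith
  set α : ℝ := -6 / (1 + b) with hα
  set β : ℝ := 6 / ((1 + b) * (6 + 2 * b)) with hβ
  set K : ℝ := 1 + |α| + |β| with hK
  have hp : 0 < 1 - b := by linarith
  have habs : 0 ≤ |α| ∧ 0 ≤ |β| := ⟨abs_nonneg _, abs_nonneg _⟩
  have hKpos : 0 ≤ K := by linarith
  have hy4 : ∀ y ∈ Icc (0:ℝ) 1, y ^ 4 ≤ y ^ (1 - b) := by
    intro y hy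
    rcases hy.1.eq_or_lt with h0 | h0
    · rw [← h0]; simp [Real.zero_rpow hp.ne']
    · rw [show y ^ 4 = y ^ (4:ℝ) by norm_cast]
      exact Real.rpow_le_rpow_of_exponent_ge h0 hy.2 (by linarith)
  have hlow : ∀ x ∈ Icc (-1:ℝ) 1, ∀ y ∈ Icc (0:ℝ) 1,
      x ^ 4 + y ^ (1 - b) ≤ x ^ 4 + α * x ^ 2 * y ^ 2 + β * y ^ 4 + K * y ^ (1 - b) := by
    intro x hx y hy
    have h1 : -(|β| * y ^ (1 - b)) ≤ β * y ^ 4 := by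
      have := mul_le_mul_of_nonneg_left (hy4 y hy) habs.2
      have h2 := neg_abs_le β
      have h3 : 0 ≤ y ^ 4 := by positivity
      nlinarith
    have h2 : -(|α| * y ^ (1 - b)) ≤ α * x ^ 2 * y ^ 2 := by
      have hyp : 0 ≤ y ^ (1 - b) := Real.rpow_nonneg hy.1 _
      have hx2 : x ^ 2 ≤ 1 := by nlinarith [hx.1, hx.2]
      rcases lt_or_gt_of_ne hbne with h | h
      · have : 0 ≤ α := by
          rw [hα]; exact div_nonneg_of_nonpos (by norm_num) (by linarith)
        have h4 : 0 ≤ α * x ^ 2 * y ^ 2 := by positivity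
        nlinarith [mul_nonneg habs.1 hyp]
      · have hy2 : y ^ 2 ≤ y ^ (1 - b) := by
          rcases hy.1.eq_or_lt with h0 | h0
          · rw [← h0]; simp [Real.zero_rpow hp.ne']
          · rw [show y ^ 2 = y ^ (2:ℝ) by norm_cast]
            exact Real.rpow_le_rpow_of_exponent_ge h0 hy.2 (by linarith)
        have h5 : x ^ 2 * y ^ 2 ≤ y ^ (1 - b) := by nlinarith [sq_nonneg y]
        have h6 : 0 ≤ x ^ 2 * y ^ 2 := by positivity
        have h7 := mul_le_mul_of_nonneg_left h5 habs.1
        have h8 := neg_abs_le α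
        nlinarith
    rw [hK]
    nlinarith
  refine ⟨K + |β|, by linarith, ?_⟩
  intro φ M hM hφ hc hbd h0 y hy
  have main := maxp (b := b) (x1 := -1) (x2 := 1) (y1 := 0) (y2 := 1)
    (φ := fun x y => φ x y + ((-M) * (x ^ 4 + α * x ^ 2 * y ^ 2 + β * y ^ 4) + (-(M * K)) * y ^ (1 - b)))
    le_rfl ?_ ?_ ?_ 0 (by norm_num) y hy
  · have h4 := mul_le_mul_of_nonneg_left (hy4 y hy) habs.2
    have h5 : β * y ^ 4 ≤ |β| * y ^ 4 := mul_le_mul_of_nonneg_right (le_abs_self β) (by positivity)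
    have h6 := mul_le_mul_of_nonneg_left (h5.trans h4) hM
    nlinarith
  · refine hφ.add ?_
    refine PSub.mono ((psub_quart b (-M) hb1' hb3'.ne').add (psub_rpow b (-(M * K)))) ?_
    rintro ⟨x, y⟩ ⟨_, h⟩
    exact h.1
  · refine hc.add ?_
    apply Continuous.continuousOn
    have : Continuous fun p : ℝ × ℝ => p.2 ^ (1 - b) :=
      continuous_snd.rpow_const fun _ => Or.inr hp.le
    fun_prop
  · intro x hx y hy hb
    have hl := mul_le_mul_of_nonneg_left (hlow x hx y hy) hM
    have hyp : 0 ≤ y ^ (1 - b) := Real.rpow_nonneg hy.1 _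
    have hx4 : 0 ≤ x ^ 4 := by positivity
    rcases hb with h | h | h | h
    · have := hbd x hx y hy
      have e : x ^ 4 = 1 := by rw [h]; norm_num
      have := mul_nonneg hM hyp
      nlinarith
    · have := hbd x hx y hy
      have e : x ^ 4 = 1 := by rw [h]; norm_num
      have := mul_nonneg hM hyp
      nlinarith
    · have := h0 x hx
      have e : φ x y ≤ 0 := by rw [h]; exact this
      have := mul_nonneg hM (add_nonneg hx4 hyp)
      nlinarith
    · have := hbd x hx y hy
      have e : y ^ (1 - b) = 1 := by rw [h]; simp
      have := mul_nonneg hM hx4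
      nlinarith

/-- The closed upper half plane. -/
def CH : Set (ℝ × ℝ) := {p | 0 ≤ p.2}

lemma box {b : ℝ} (hb : -3 < b) (hb1 : b < 1) (hbne : b ≠ -1) :
    ∃ C : ℝ, 0 ≤ C ∧ ∀ (φ : ℝ → ℝ → ℝ) (M x0 ρ : ℝ), 0 ≤ M → 0 < ρ →
      PSub b UH φ →
      ContinuousOn (fun p : ℝ × ℝ => φ p.1 p.2) CH →
      (∀ x y, |x - x0| ≤ ρ → 0 ≤ y → y ≤ ρ → φ x y ≤ M) →
      (∀ x, |x - x0| ≤ ρ → φ x 0 ≤ 0) →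
      ∀ y, 0 ≤ y → y ≤ ρ → φ x0 y ≤ M * (C * (y / ρ) ^ (1 - b)) := by
  obtain ⟨C, hC, h⟩ := box_unit hb hb1 hbne
  refine ⟨C, hC, fun φ M x0 ρ hM hρ hφ hc hbd h0 y hy hyρ => ?_⟩
  have habs : ∀ x ∈ Icc (-1:ℝ) 1, |x0 + ρ * x - x0| ≤ ρ := by
    intro x hx
    rw [add_sub_cancel_left, abs_mul, abs_of_pos hρ]
    have := abs_le.2 hx
    nlinarith
  have := h (fun x y => φ (x0 + ρ * x) (ρ * y)) M hM ?_ ?_ ?_ ?_ (y / ρ)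
    ⟨by positivity, (div_le_one hρ).2 hyρ⟩
  · simpa [mul_div_cancel₀ y hρ.ne'] using this
  · refine PSub.comp hρ rfl hφ ?_
    rintro x y ⟨_, hy⟩
    exact mul_pos hρ hy.1
  · have : ContinuousOn (fun p : ℝ × ℝ => (x0 + ρ * p.1, ρ * p.2)) (Icc (-1) 1 ×ˢ Icc 0 1) := by
      fun_prop
    refine ContinuousOn.comp hc this ?_
    rintro ⟨x, y⟩ ⟨_, hy⟩
    exact mul_nonneg hρ.le hy.1
  · intro x hx y hy
    exact hbd _ _ (habs x hx) (mul_nonneg hρ.le hy.1) (by nlinarith [hy.2])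
  · intro x hx
    simpa using h0 _ (habs x hx)

/-- Liouville-type comparison. -/
lemma liouville {b : ℝ} (hb : -3 < b) (hb1 : b < 1) (hbne : b ≠ -1) {φ : ℝ → ℝ → ℝ} {M : ℝ}
    (hφ : PSub b UH φ) (hc : ContinuousOn (fun p : ℝ × ℝ => φ p.1 p.2) CH)
    (hM : ∀ x y, 0 ≤ y → φ x y ≤ M) (h0 : ∀ x, φ x 0 ≤ 0) :
    ∀ x y, 0 ≤ y → φ x y ≤ 0 := by
  obtain ⟨C, hC, h⟩ := box hb hb1 hbne
  intro x y hy
  have hlim : Tendsto (fun ρ : ℝ => max M 0 * (C * (y / ρ) ^ (1 - b))) atTop (nhds 0) := by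
    have h1 : Tendsto (fun ρ : ℝ => y / ρ) atTop (nhds 0) := tendsto_const_nhds.div_atTop tendsto_id
    have h2 := h1.rpow_const (p := 1 - b) (Or.inr (by linarith))
    rw [Real.zero_rpow (by linarith)] at h2
    simpa using (h2.const_mul C).const_mul (max M 0)
  refine ge_of_tendsto hlim ?_
  filter_upwards [eventually_gt_atTop 0, eventually_ge_atTop y] with ρ h1 h2
  exact h φ (max M 0) x ρ (le_max_right _ _) h1 hφ hc
    (fun x y _ hy _ => (hM x y hy).trans (le_max_left _ _)) (fun x _ => h0 x) y hy h2

open Real MeasureTheory Filter Set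

/-- Solutions: both `φ` and `-φ` are subsolutions. -/
def PSol (b : ℝ) (φ : ℝ → ℝ → ℝ) : Prop := PSub b UH φ ∧ PSub b UH (fun x y => -φ x y)

lemma PSol.neg {b : ℝ} {φ : ℝ → ℝ → ℝ} (h : PSol b φ) : PSol b (fun x y => -φ x y) :=
  ⟨h.2, by simpa using h.1⟩

lemma psub_bar {b d y0 : ℝ} (hd : y0 = 2 * d) (hd0 : 0 < d) (c : ℝ) (hc : 0 ≤ c) :
    PSub b (Ioo 0 d ×ˢ Ioo (y0 - d) (y0 + d))
      (fun x y => -c * (x ^ 2 + (y - y0) ^ 2 + (2 + |b|) * (x * (d - x)))) := by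
  refine ⟨fun x _ => -c * (2 * x + (2 + |b|) * (d - 2 * x)), fun _ _ => -c * (2 + (2 + |b|) * (-2)),
    fun _ y => -c * (2 * (y - y0)), fun _ _ => -c * 2, ?_⟩
  rintro x y ⟨hx, hy⟩
  simp only at hx hy
  refine ⟨?_, ?_, ?_, ?_, ?_⟩
  · refine HasDerivAt.const_mul (-c) ?_
    have h := hasDerivAt_id x
    have := ((h.fun_pow 2).add_const ((y - y0) ^ 2)).fun_add ((h.fun_mul (h.const_sub d)).const_mul (2 + |b|))
    refine this.congr_deriv ?_
    simp only [id]
    push_cast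
    ring
  · refine HasDerivAt.const_mul (-c) ?_
    have h := hasDerivAt_id x
    have := (h.const_mul 2).fun_add (((h.const_mul 2).const_sub d).const_mul (2 + |b|))
    refine this.congr_deriv ?_
    ring
  · refine HasDerivAt.const_mul (-c) ?_
    have h := (hasDerivAt_id y).sub_const y0
    have := ((h.fun_pow 2).const_add (x ^ 2)).add_const ((2 + |b|) * (x * (d - x)))
    refine this.congr_deriv ?_
    simp
  · refine HasDerivAt.const_mul (-c) ?_
    have h := (hasDerivAt_id y).sub_const y0
    refine (h.const_mul 2).congr_deriv ?_
    simp
  · have hyd : d < y := by linarith [hy.1]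
    have h1 : |y - y0| ≤ y := abs_le.2 ⟨by linarith [hy.1], by linarith⟩
    have h2 : b * (y - y0) ≤ |b| * y := by
      calc b * (y - y0) ≤ |b * (y - y0)| := le_abs_self _
        _ = |b| * |y - y0| := abs_mul _ _
        _ ≤ _ := mul_le_mul_of_nonneg_left h1 (abs_nonneg _)
    have := mul_le_mul_of_nonneg_left h2 hc
    nlinarith

lemma int_odd {b : ℝ} {φ : ℝ → ℝ → ℝ} (h : PSol b φ)
    (hc : ContinuousOn (fun p : ℝ × ℝ => φ p.1 p.2) UH) {y0 d M x0 : ℝ} (hd : y0 = 2 * d)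
    (hd0 : 0 < d) (hM : ∀ x y, d ≤ y → y ≤ 3 * d → |φ x y| ≤ M) :
    ∀ x ∈ Icc (0:ℝ) d, φ (x0 + x) y0 - φ (x0 - x) y0 ≤
      2 * M / d ^ 2 * (x ^ 2 + (2 + |b|) * (x * (d - x))) := by
  intro x hx
  have hM0 : 0 ≤ M := (abs_nonneg _).trans (hM 0 d le_rfl (by linarith))
  have main := maxp (b := b) (x1 := 0) (x2 := d) (y1 := y0 - d) (y2 := y0 + d)
    (φ := fun x y => (φ (x0 + 1 * x) (1 * y) + -φ (x0 + (-1) * x) (1 * y)) +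
      (-(2 * M / d ^ 2) * (x ^ 2 + (y - y0) ^ 2 + (2 + |b|) * (x * (d - x)))))
    (by linarith) ?_ ?_ ?_ x hx y0 ⟨by linarith, by linarith⟩
  · simp only [one_mul, neg_mul, sub_self] at main
    rw [← sub_eq_add_neg x0 x] at main
    nlinarith
  · refine PSub.add (PSub.add ?_ ?_) (psub_bar hd hd0 _ (by positivity))
    · refine PSub.comp one_pos (by norm_num) h.1 ?_
      rintro x y ⟨_, hy⟩
      have := hy.1
      simp only [UH, mem_ofPred_eq] at this ⊢
      linarith
    · refine PSub.comp (φ := fun x y => -φ x y) one_pos (by norm_num) h.2 ?_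
      rintro x y ⟨_, hy⟩
      have := hy.1
      simp only [UH, mem_ofPred_eq] at this ⊢
      linarith
  · have hmaps : ∀ σ : ℝ, ContinuousOn (fun p : ℝ × ℝ => φ (x0 + σ * p.1) (1 * p.2))
        (Icc 0 d ×ˢ Icc (y0 - d) (y0 + d)) := by
      intro σ
      have : ContinuousOn (fun p : ℝ × ℝ => (x0 + σ * p.1, 1 * p.2))
        (Icc 0 d ×ˢ Icc (y0 - d) (y0 + d)) := by fun_prop
      refine ContinuousOn.comp hc this ?_
      rintro ⟨x, y⟩ ⟨_, hy⟩
      have := hy.1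
      simp only [UH, mem_ofPred_eq] at this ⊢
      linarith
    refine ((hmaps 1).add (hmaps (-1)).neg).add ?_
    fun_prop
  · intro x hx y hy hb
    have hyr : d ≤ y ∧ y ≤ 3 * d := ⟨by linarith [hy.1], by linarith [hy.2]⟩
    have a1 := abs_le.1 (hM (x0 + 1 * x) (1 * y) (by linarith) (by linarith))
    have a2 := abs_le.1 (hM (x0 + (-1) * x) (1 * y) (by linarith) (by linarith))
    have hxx : 0 ≤ (2 + |b|) * (x * (d - x)) :=
      mul_nonneg (by positivity) (mul_nonneg hx.1 (by linarith [hx.2]))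
    have hcc : 0 ≤ 2 * M / d ^ 2 := by positivity
    have key : d ^ 2 ≤ x ^ 2 + (y - y0) ^ 2 + (2 + |b|) * (x * (d - x)) →
      (φ (x0 + 1 * x) (1 * y) + -φ (x0 + (-1) * x) (1 * y)) +
      (-(2 * M / d ^ 2) * (x ^ 2 + (y - y0) ^ 2 + (2 + |b|) * (x * (d - x)))) ≤ 0 := by
      intro hk
      have := mul_le_mul_of_nonneg_left hk hcc
      rw [div_mul_cancel₀ _ (by positivity : d ^ 2 ≠ 0)] at this
      linarith
    rcases hb with h | h | h | h
    · have e : φ (x0 + 1 * x) (1 * y) = φ (x0 + (-1) * x) (1 * y) := by rw [h]; simp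
      have : 0 ≤ x ^ 2 + (y - y0) ^ 2 + (2 + |b|) * (x * (d - x)) := by positivity
      have := mul_nonneg hcc this
      rw [e]
      linarith
    · apply key; rw [h] at hxx ⊢; nlinarith [sq_nonneg (y - y0)]
    · apply key; rw [h]; nlinarith [sq_nonneg x]
    · apply key; rw [h]; nlinarith [sq_nonneg x]

lemma grad_aux {b : ℝ} {φ : ℝ → ℝ → ℝ} (h : PSol b φ)
    (hc : ContinuousOn (fun p : ℝ × ℝ => φ p.1 p.2) UH) {y0 M x0 D : ℝ} (hy0 : 0 < y0)
    (hM : ∀ x y, y0 / 2 ≤ y → y ≤ 2 * y0 → |φ x y| ≤ M)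
    (hD : HasDerivAt (fun x => φ x y0) D x0) : D ≤ 2 * (2 + |b|) * M / y0 := by
  set d := y0 / 2 with hd
  have hd0 : 0 < d := by positivity
  have hy : y0 = 2 * d := by rw [hd]; ring
  have hodd := int_odd h hc hy hd0 (x0 := x0) (fun x y h1 h2 => hM x y h1 (by linarith))
  have e1 : HasDerivAt (fun x : ℝ => φ (x0 + x) y0) D 0 := by
    have : HasDerivAt (fun x => φ x y0) D (x0 + 0) := by simpa using hD
    simpa using this.comp_const_add x0 0
  have e2 : HasDerivAt (fun x : ℝ => φ (x0 - x) y0) (-D) 0 := by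
    have : HasDerivAt (fun x => φ x y0) D (x0 - 0) := by simpa using hD
    simpa using this.comp_const_sub x0 0
  have e3 : HasDerivAt (fun x : ℝ => 2 * M / d ^ 2 * (x ^ 2 + (2 + |b|) * (x * (d - x))))
      (2 * M / d ^ 2 * ((2 + |b|) * d)) 0 := by
    refine HasDerivAt.const_mul _ ?_
    have h := hasDerivAt_id (0:ℝ)
    have := (h.fun_pow 2).fun_add ((h.fun_mul (h.const_sub d)).const_mul (2 + |b|))
    refine this.congr_deriv ?_
    simp
  have e := (e1.fun_sub e2).fun_sub e3
  have hsl := e.tendsto_slope_zero_right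
  have hle : D - -D - 2 * M / d ^ 2 * ((2 + |b|) * d) ≤ 0 := by
    refine le_of_tendsto hsl ?_
    filter_upwards [Ioo_mem_nhdsGT hd0] with t ht
    have := hodd t ⟨ht.1.le, ht.2.le⟩
    have ht1 : 0 < t⁻¹ := inv_pos.2 ht.1
    simp only [smul_eq_mul, zero_add]
    apply mul_nonpos_of_nonneg_of_nonpos ht1.le
    simp
    linarith
  have e5 : 2 * M / d ^ 2 * ((2 + |b|) * d) = 2 * (2 * (2 + |b|) * M / y0) := by
    rw [hy]; field_simp
  rw [e5] at hle
  linarith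

lemma grad_bound {b : ℝ} {φ : ℝ → ℝ → ℝ} (h : PSol b φ)
    (hc : ContinuousOn (fun p : ℝ × ℝ => φ p.1 p.2) UH) {y0 M x0 D : ℝ} (hy0 : 0 < y0)
    (hM : ∀ x y, y0 / 2 ≤ y → y ≤ 2 * y0 → |φ x y| ≤ M)
    (hD : HasDerivAt (fun x => φ x y0) D x0) : |D| ≤ 2 * (2 + |b|) * M / y0 := by
  rw [abs_le']
  refine ⟨grad_aux h hc hy0 hM hD, grad_aux h.neg hc.neg hy0 (fun x y h1 h2 => ?_) hD.neg⟩
  simpa using hM x y h1 h2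

/-- Lipschitz version. -/
lemma lip_bound {b : ℝ} {φ : ℝ → ℝ → ℝ} (h : PSol b φ)
    (hc : ContinuousOn (fun p : ℝ × ℝ => φ p.1 p.2) UH) {y0 M : ℝ} (hy0 : 0 < y0)
    (hM : ∀ x y, y0 / 2 ≤ y → y ≤ 2 * y0 → |φ x y| ≤ M) (x x' : ℝ) :
    |φ x' y0 - φ x y0| ≤ 2 * (2 + |b|) * M / y0 * |x' - x| := by
  obtain ⟨p, q, r, t, hh⟩ := id h.1
  have hd : ∀ z, HasDerivAt (fun x => φ x y0) (p z y0) z := fun z => (hh z y0 hy0).1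
  have := Convex.norm_image_sub_le_of_norm_hasDerivWithin_le (f := fun x => φ x y0)
    (f' := fun z => p z y0) (s := univ) (x := x) (y := x') (C := 2 * (2 + |b|) * M / y0)
    (fun z _ => (hd z).hasDerivWithinAt)
    (fun z _ => grad_bound h hc hy0 hM (hd z)) convex_univ (mem_univ _) (mem_univ _)
  simpa using this

open Real MeasureTheory Filter Set

/-- Data of a bounded solution of the linear extension problem. -/
structure ED (a M C0 : ℝ) (u ux uy uxx uyy : ℝ → ℝ → ℝ) (g : ℝ → ℝ) : Prop where
  ha : -1 < a
  ha1 : a < 1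
  bdd : ∀ x y, 0 ≤ y → |u x y| ≤ M
  cont : ContinuousOn (fun p : ℝ × ℝ => u p.1 p.2) CH
  dx : ∀ x y, 0 < y → HasDerivAt (fun r => u r y) (ux x y) x
  dxx : ∀ x y, 0 < y → HasDerivAt (fun r => ux r y) (uxx x y) x
  dy : ∀ x y, 0 < y → HasDerivAt (fun r => u x r) (uy x y) y
  dyy : ∀ x y, 0 < y → HasDerivAt (fun r => uy x r) (uyy x y) y
  cx : ContinuousOn (fun p : ℝ × ℝ => ux p.1 p.2) UH
  cy : ContinuousOn (fun p : ℝ × ℝ => uy p.1 p.2) UH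
  cxx : ContinuousOn (fun p : ℝ × ℝ => uxx p.1 p.2) UH
  eqn : ∀ x y, 0 < y → y * (uxx x y + uyy x y) + a * uy x y = 0
  neu : ∀ x, Tendsto (fun y => y ^ a * uy x y) (nhdsWithin 0 (Ioi 0)) (nhds (g x))
  gb : ∀ x, |g x| ≤ C0

section
variable {a M C0 : ℝ} {u ux uy uxx uyy : ℝ → ℝ → ℝ} {g : ℝ → ℝ}

lemma ED.neg (h : ED a M C0 u ux uy uxx uyy g) :
    ED a M C0 (fun x y => -u x y) (fun x y => -ux x y) (fun x y => -uy x y) (fun x y => -uxx x y)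
      (fun x y => -uyy x y) (fun x => -g x) where
  ha := h.ha
  ha1 := h.ha1
  bdd x y hy := by simpa using h.bdd x y hy
  cont := h.cont.neg
  dx x y hy := (h.dx x y hy).fun_neg
  dxx x y hy := (h.dxx x y hy).fun_neg
  dy x y hy := (h.dy x y hy).fun_neg
  dyy x y hy := (h.dyy x y hy).fun_neg
  cx := h.cx.neg
  cy := h.cy.neg
  cxx := h.cxx.neg
  eqn x y hy := by have := h.eqn x y hy; linarith
  neu x := by simpa using (h.neu x).neg
  gb x := by simpa using h.gb x

lemma ED.psub (h : ED a M C0 u ux uy uxx uyy g) : PSub a UH u :=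
  ⟨ux, uxx, uy, uyy, fun x y hy => ⟨h.dx x y hy, h.dxx x y hy, h.dy x y hy, h.dyy x y hy,
    (h.eqn x y hy).ge⟩⟩

lemma ED.psol (h : ED a M C0 u ux uy uxx uyy g) : PSol a u := ⟨h.psub, h.neg.psub⟩

lemma ED.M0 (h : ED a M C0 u ux uy uxx uyy g) : 0 ≤ M := (abs_nonneg _).trans (h.bdd 0 0 le_rfl)

lemma UH_sub : UH ⊆ CH := fun p h => by
  have h : 0 < p.2 := h
  exact h.le

lemma ED.ux_le (h : ED a M C0 u ux uy uxx uyy g) (x y : ℝ) (hy : 0 < y) :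
    |ux x y| ≤ 2 * (2 + |a|) * M / y :=
  grad_bound h.psol (h.cont.mono UH_sub) hy (fun x' y' h1 _ => h.bdd x' y' (by linarith))
    (h.dx x y hy)

lemma ED.lip (h : ED a M C0 u ux uy uxx uyy g) (x x' y : ℝ) (hy : 0 < y) :
    |u x' y - u x y| ≤ 2 * (2 + |a|) * M / y * |x' - x| :=
  lip_bound h.psol (h.cont.mono UH_sub) hy (fun x' y' h1 _ => h.bdd x' y' (by linarith)) x x'

lemma PSub.trans {b : ℝ} {φ : ℝ → ℝ → ℝ} (h : PSub b UH φ) (c : ℝ) :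
    PSub b UH (fun x y => φ (x + c) y) := by
  have := PSub.comp (c := c) (σ := 1) (ρ := 1) (S := UH) one_pos rfl h
    (fun x y hy => by simp only [UH, mem_ofPred_eq, one_mul] at hy ⊢; exact hy)
  simpa [add_comm] using this

lemma PSol.trans {b : ℝ} {φ : ℝ → ℝ → ℝ} (h : PSol b φ) (c : ℝ) :
    PSol b (fun x y => φ (x + c) y) := ⟨h.1.trans c, PSub.trans (φ := fun x y => -φ x y) h.2 c⟩

lemma PSol.add {b : ℝ} {φ ψ : ℝ → ℝ → ℝ} (h : PSol b φ) (k : PSol b ψ) :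
    PSol b (fun x y => φ x y + ψ x y) := by
  refine ⟨h.1.add k.1, ?_⟩
  have := h.2.add k.2
  simpa [add_comm] using this

lemma PSol.smul {b : ℝ} {φ : ℝ → ℝ → ℝ} (h : PSol b φ) (c : ℝ) :
    PSol b (fun x y => c * φ x y) := by
  rcases le_total 0 c with hc | hc
  · refine ⟨h.1.smul hc, ?_⟩
    have := h.2.smul hc
    simpa using this
  · have hc' : 0 ≤ -c := by linarith
    refine ⟨?_, ?_⟩
    · have := h.2.smul hc'
      simpa using this
    · have := h.1.smul hc'
      simpa using this

lemma cont_trans {φ : ℝ → ℝ → ℝ} {S : Set (ℝ × ℝ)} (hc : ContinuousOn (fun p : ℝ × ℝ => φ p.1 p.2) S)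
    (c : ℝ) (hS : ∀ x y, (x, y) ∈ S → (x + c, y) ∈ S) :
    ContinuousOn (fun p : ℝ × ℝ => φ (p.1 + c) p.2) S := by
  have : ContinuousOn (fun p : ℝ × ℝ => (p.1 + c, p.2)) S := by fun_prop
  exact ContinuousOn.comp hc this (fun p hp => hS p.1 p.2 hp)

lemma ED.uxx_le (h : ED a M C0 u ux uy uxx uyy g) (x y : ℝ) (hy : 0 < y) :
    |uxx x y| ≤ 2 * (2 * (2 + |a|)) ^ 2 * M / y ^ 2 := by
  have hM := h.M0
  have key : ∀ k : ℝ, k ≠ 0 → |k⁻¹ * (ux (x + k) y - ux x y)| ≤ 2 * (2 * (2 + |a|)) ^ 2 * M / y ^ 2 := by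
    intro k hk
    have hps : PSol a (fun x y => k⁻¹ * (u (x + k) y + -u x y)) :=
      ((h.psol.trans k).add h.psol.neg).smul k⁻¹
    have hcu := h.cont.mono UH_sub
    have hcc : ContinuousOn (fun p : ℝ × ℝ => k⁻¹ * (u (p.1 + k) p.2 + -u p.1 p.2)) UH :=
      ((cont_trans hcu k (fun x y hy => hy)).add hcu.neg).const_mul k⁻¹
    have hd : HasDerivAt (fun r => k⁻¹ * (u (r + k) y + -u r y)) (k⁻¹ * (ux (x + k) y + -ux x y)) x := by
      refine HasDerivAt.const_mul _ (HasDerivAt.fun_add ?_ (h.dx x y hy).fun_neg)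
      exact (h.dx (x + k) y hy).comp_add_const x k
    have := grad_bound (M := 2 * (2 + |a|) * M / (y / 2)) hps hcc hy ?_ hd
    · rw [← sub_eq_add_neg] at this
      refine this.trans (le_of_eq ?_)
      field_simp
    · intro x' y' h1 h2
      have hy' : 0 < y' := by linarith
      have := h.lip x' (x' + k) y' hy'
      rw [add_sub_cancel_left] at this
      rw [abs_mul, abs_inv, ← sub_eq_add_neg]
      have hk' : 0 < |k| := abs_pos.2 hk
      rw [inv_mul_le_iff₀ hk', mul_comm]
      refine this.trans (mul_le_mul_of_nonneg_right ?_ hk'.le)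
      gcongr
  have hl := (h.dxx x y hy).tendsto_slope_zero
  refine le_of_tendsto hl.abs ?_
  filter_upwards [self_mem_nhdsWithin] with k hk
  exact key k hk

lemma ED.dw (h : ED a M C0 u ux uy uxx uyy g) (x y : ℝ) (hy : 0 < y) :
    HasDerivAt (fun t => t ^ a * uy x t) (-(y ^ a * uxx x y)) y := by
  have h1 := (Real.hasDerivAt_rpow_const (p := a) (Or.inl hy.ne')).fun_mul (h.dyy x y hy)
  refine h1.congr_deriv ?_
  have e : y ^ a = y ^ (a - 1) * y := by
    rw [← Real.rpow_add_one hy.ne']; ring_nf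
  rw [e]
  have := h.eqn x y hy
  linear_combination y ^ (a - 1) * this

lemma ED.uy_le (h : ED a M C0 u ux uy uxx uyy g) :
    ∃ C, 0 ≤ C ∧ ∀ x y, 0 < y → |uy x y| ≤ C / y := by
  have hM := h.M0
  set B := 2 * (2 * (2 + |a|)) ^ 2 * M with hB
  have hB0 : 0 ≤ B := by positivity
  refine ⟨4 * M + 2 * B, by positivity, fun x y hy => ?_⟩
  have hyy : y < 2 * y := by linarith
  obtain ⟨ξ, hξ, he⟩ := exists_hasDerivAt_eq_slope (fun r => u x r) (fun r => uy x r) hyy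
    (fun z hz => (h.dy x z (by linarith [hz.1])).continuousAt.continuousWithinAt)
    (fun z hz => h.dy x z (by linarith [hz.1]))
  have hpow : ∀ t ∈ Icc y (2 * y), t ^ a ≤ 2 * y ^ a := by
    intro t ht
    have h1 : 1 ≤ t / y := (one_le_div hy).2 ht.1
    have h2 : (t / y) ^ a ≤ 2 := by
      calc (t / y) ^ a ≤ (t / y) ^ (1:ℝ) := Real.rpow_le_rpow_of_exponent_le h1 h.ha1.le
        _ = t / y := Real.rpow_one _
        _ ≤ 2 := (div_le_iff₀ hy).2 ht.2
    rw [Real.div_rpow (by linarith [ht.1]) hy.le] at h2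
    exact (div_le_iff₀ (Real.rpow_pos_of_pos hy a)).1 h2
  have hya : 0 < y ^ a := Real.rpow_pos_of_pos hy a
  have hξ' : |uy x ξ| ≤ 2 * M / y := by
    rw [he, abs_div, show 2 * y - y = y by ring, abs_of_pos hy]
    gcongr
    have := abs_sub (u x (2 * y)) (u x y)
    linarith [h.bdd x (2 * y) (by linarith), h.bdd x y hy.le]
  have hw : ‖y ^ a * uy x y - ξ ^ a * uy x ξ‖ ≤ (2 * y ^ a * (B / y ^ 2)) * ‖y - ξ‖ := by
    refine Convex.norm_image_sub_le_of_norm_hasDerivWithin_le (f := fun t => t ^ a * uy x t)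
      (f' := fun t => -(t ^ a * uxx x t)) (s := Icc y (2 * y))
      (fun z hz => (h.dw x z (by linarith [hz.1])).hasDerivWithinAt) ?_ (convex_Icc _ _)
      ⟨hξ.1.le, hξ.2.le⟩ ⟨le_rfl, hyy.le⟩
    intro z hz
    have hz0 : 0 < z := by linarith [hz.1]
    have hza : 0 < z ^ a := Real.rpow_pos_of_pos hz0 a
    rw [norm_neg, norm_mul, Real.norm_eq_abs, Real.norm_eq_abs, abs_of_pos hza]
    have h1 := h.uxx_le x z hz0
    rw [← hB] at h1
    have h2 : B / z ^ 2 ≤ B / y ^ 2 := by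
      have := hz.1
      gcongr
    exact mul_le_mul (hpow z hz) (h1.trans h2) (abs_nonneg _) (by positivity)
  rw [Real.norm_eq_abs, Real.norm_eq_abs] at hw
  have h3 : |y - ξ| ≤ y := abs_le.2 ⟨by linarith [hξ.2], by linarith [hξ.1]⟩
  have h4 : (2 * y ^ a * (B / y ^ 2)) * |y - ξ| ≤ y ^ a * (2 * B / y) := by
    calc _ ≤ (2 * y ^ a * (B / y ^ 2)) * y := by gcongr
      _ = _ := by field_simp
  have h5 : |ξ ^ a * uy x ξ| ≤ y ^ a * (4 * M / y) := by
    rw [abs_mul, abs_of_pos (Real.rpow_pos_of_pos (hy.trans hξ.1) a)]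
    calc _ ≤ (2 * y ^ a) * (2 * M / y) :=
          mul_le_mul (hpow ξ ⟨hξ.1.le, hξ.2.le⟩) hξ' (abs_nonneg _) (by positivity)
      _ = _ := by ring
  have h6 : y ^ a * |uy x y| ≤ y ^ a * ((4 * M + 2 * B) / y) := by
    have e : y ^ a * |uy x y| = |y ^ a * uy x y| := by rw [abs_mul, abs_of_pos hya]
    rw [e]
    have := abs_sub_abs_le_abs_sub (y ^ a * uy x y) (ξ ^ a * uy x ξ)
    have e2 : y ^ a * ((4 * M + 2 * B) / y) = y ^ a * (4 * M / y) + y ^ a * (2 * B / y) := by ring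
    linarith
  exact le_of_mul_le_mul_left h6 hya

lemma ED.est (h : ED a M C0 u ux uy uxx uyy g) :
    ∃ C, 0 ≤ C ∧ ∀ x y, 0 < y → |ux x y| ≤ C / y ∧ |uxx x y| ≤ C / y ^ 2 ∧ |uy x y| ≤ C / y ∧
      |uyy x y| ≤ C / y ^ 2 := by
  obtain ⟨C1, hC1, h1⟩ := h.uy_le
  have hM := h.M0
  set A := 2 * (2 + |a|) * M with hA
  set B := 2 * (2 * (2 + |a|)) ^ 2 * M with hB
  have hA0 : 0 ≤ A := by positivity
  have hB0 : 0 ≤ B := by positivity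
  refine ⟨A + 2 * B + 2 * C1, by positivity, fun x y hy => ?_⟩
  have e1 := h.ux_le x y hy
  have e2 := h.uxx_le x y hy
  have e3 := h1 x y hy
  refine ⟨e1.trans (by gcongr; linarith), e2.trans (by gcongr; linarith), e3.trans (by gcongr; linarith), ?_⟩
  have e : uyy x y = -uxx x y - a / y * uy x y := by
    have := h.eqn x y hy
    field_simp
    linarith
  have h4 : |a / y * uy x y| ≤ C1 / y ^ 2 := by
    rw [abs_mul, abs_div, abs_of_pos hy]
    have : |a| ≤ 1 := abs_le.2 ⟨h.ha.le, h.ha1.le⟩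
    calc |a| / y * |uy x y| ≤ 1 / y * (C1 / y) := by gcongr
      _ = _ := by field_simp
  have h5 : |uyy x y| ≤ |uxx x y| + |a / y * uy x y| := by
    rw [e]
    have := abs_sub (-uxx x y) (a / y * uy x y)
    rwa [abs_neg] at this
  calc |uyy x y| ≤ B / y ^ 2 + C1 / y ^ 2 := h5.trans (add_le_add e2 h4)
    _ = (B + C1) / y ^ 2 := by ring
    _ ≤ _ := div_le_div_of_nonneg_right (by linarith) (by positivity)
end

open Real MeasureTheory Filter Set

/-- Second x-primitive of the conormal derivative. -/
noncomputable def TH (a : ℝ) (u uy : ℝ → ℝ → ℝ) (x y : ℝ) : ℝ :=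
  (∫ z in (0:ℝ)..x, ∫ z' in (0:ℝ)..z, uy z' 1) - ∫ t in (1:ℝ)..y, t ^ a * u x t

section
variable {a M C0 : ℝ} {u ux uy uxx uyy : ℝ → ℝ → ℝ} {g : ℝ → ℝ}

lemma slice_cont {φ : ℝ → ℝ → ℝ} {S : Set (ℝ × ℝ)} {T : Set ℝ} {x : ℝ}
    (hc : ContinuousOn (fun p : ℝ × ℝ => φ p.1 p.2) S)
    (hS : ∀ y ∈ T, (x, y) ∈ S) : ContinuousOn (fun y => φ x y) T := by
  have : ContinuousOn (fun y : ℝ => (x, y)) T := by fun_prop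
  exact ContinuousOn.comp (g := fun p : ℝ × ℝ => φ p.1 p.2) (f := fun y : ℝ => (x, y)) hc this hS

lemma slice_cont' {φ : ℝ → ℝ → ℝ} {S : Set (ℝ × ℝ)} {y : ℝ}
    (hc : ContinuousOn (fun p : ℝ × ℝ => φ p.1 p.2) S)
    (hS : ∀ x, (x, y) ∈ S) : Continuous (fun x => φ x y) := by
  rw [← continuousOn_univ]
  have : ContinuousOn (fun x : ℝ => (x, y)) univ := by fun_prop
  exact ContinuousOn.comp (g := fun p : ℝ × ℝ => φ p.1 p.2) (f := fun x : ℝ => (x, y)) hc this (fun x _ => hS x)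

lemma uIcc_pos {y1 y2 t : ℝ} (h1 : 0 < y1) (h2 : 0 < y2) (ht : t ∈ uIcc y1 y2) : 0 < t :=
  lt_of_lt_of_le (lt_min h1 h2) ht.1

lemma uIcc_nonneg {y1 y2 t : ℝ} (h1 : 0 ≤ y1) (h2 : 0 ≤ y2) (ht : t ∈ uIcc y1 y2) : 0 ≤ t :=
  (le_min h1 h2).trans ht.1

lemma ED.intble (h : ED a M C0 u ux uy uxx uyy g) (x : ℝ) {y1 y2 : ℝ} (h1 : 0 ≤ y1) (h2 : 0 ≤ y2) :
    IntervalIntegrable (fun t => t ^ a * u x t) volume y1 y2 := by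
  refine (intervalIntegral.intervalIntegrable_rpow' h.ha).mul_continuousOn ?_
  exact slice_cont h.cont (fun t ht => uIcc_nonneg h1 h2 ht)

lemma ED.TH_sub (h : ED a M C0 u ux uy uxx uyy g) (x : ℝ) {y1 y2 : ℝ} (h1 : 0 ≤ y1) (h2 : 0 ≤ y2) :
    TH a u uy x y1 - TH a u uy x y2 = ∫ t in y1..y2, t ^ a * u x t := by
  unfold TH
  have := intervalIntegral.integral_interval_sub_left (h.intble x zero_le_one h2)
    (h.intble x zero_le_one h1)
  rw [← this]; ring

lemma ED.TH_mod (h : ED a M C0 u ux uy uxx uyy g) (x : ℝ) {y1 y2 : ℝ} (h1 : 0 ≤ y1) (h2 : 0 ≤ y2) :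
    |TH a u uy x y1 - TH a u uy x y2| ≤ M / (1 + a) * |y1 ^ (1 + a) - y2 ^ (1 + a)| := by
  wlog h12 : y1 ≤ y2 generalizing y1 y2
  · rw [abs_sub_comm, abs_sub_comm (y1 ^ (1 + a))]
    exact this h2 h1 (le_of_not_ge h12)
  rw [h.TH_sub x h1 h2]
  have hi : IntervalIntegrable (fun t : ℝ => t ^ a * M) volume y1 y2 :=
    (intervalIntegral.intervalIntegrable_rpow' h.ha).mul_const M
  have := intervalIntegral.norm_integral_le_of_norm_le h12 (μ := volume)
    (f := fun t => t ^ a * u x t) (g := fun t => t ^ a * M) ?_ hi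
  · rw [Real.norm_eq_abs] at this
    refine this.trans (le_of_eq ?_)
    rw [intervalIntegral.integral_mul_const, integral_rpow (Or.inl h.ha)]
    have ha := h.ha
    rw [abs_sub_comm, abs_of_nonneg, add_comm a 1]
    · ring
    · exact sub_nonneg.2 (Real.rpow_le_rpow h1 h12 (by linarith))
  · refine Eventually.of_forall fun t ht => ?_
    have ht0 : 0 ≤ t := h1.trans ht.1.le
    rw [norm_mul, Real.norm_eq_abs, Real.norm_eq_abs, abs_of_nonneg (Real.rpow_nonneg ht0 a)]
    exact mul_le_mul_of_nonneg_left (h.bdd x t ht0) (Real.rpow_nonneg ht0 a)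

lemma ED.w1_cont (h : ED a M C0 u ux uy uxx uyy g) : Continuous fun x => uy x 1 :=
  slice_cont' h.cy (fun _ => by simp [UH])

lemma ED.prim (h : ED a M C0 u ux uy uxx uyy g) (x : ℝ) :
    HasDerivAt (fun x => ∫ z in (0:ℝ)..x, ∫ z' in (0:ℝ)..z, uy z' 1) (∫ z' in (0:ℝ)..x, uy z' 1) x := by
  have hc : Continuous fun z => ∫ z' in (0:ℝ)..z, uy z' 1 :=
    intervalIntegral.continuous_primitive (fun _ _ => h.w1_cont.intervalIntegrable _ _) 0
  exact hc.integral_hasStrictDerivAt 0 x |>.hasDerivAt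

lemma ED.prim2 (h : ED a M C0 u ux uy uxx uyy g) (x : ℝ) :
    HasDerivAt (fun x => ∫ z' in (0:ℝ)..x, uy z' 1) (uy x 1) x :=
  h.w1_cont.integral_hasStrictDerivAt 0 x |>.hasDerivAt

lemma ED.TH_contx (h : ED a M C0 u ux uy uxx uyy g) {y : ℝ} (hy : 0 ≤ y) :
    Continuous (fun x => TH a u uy x y) := by
  unfold TH
  refine Continuous.sub ?_ ?_
  · exact continuous_iff_continuousAt.2 fun x => (h.prim x).continuousAt
  · refine intervalIntegral.continuous_of_dominated_interval (bound := fun t => t ^ a * M) ?_ ?_ ?_ ?_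
    · intro x
      exact (h.intble x zero_le_one hy).aestronglyMeasurable_restrict_uIoc
    · intro x
      refine Eventually.of_forall fun t ht => ?_
      have ht0 : 0 ≤ t := uIcc_nonneg zero_le_one hy (uIoc_subset_uIcc ht)
      rw [norm_mul, Real.norm_eq_abs, Real.norm_eq_abs, abs_of_nonneg (Real.rpow_nonneg ht0 a)]
      exact mul_le_mul_of_nonneg_left (h.bdd x t ht0) (Real.rpow_nonneg ht0 a)
    · exact (intervalIntegral.intervalIntegrable_rpow' h.ha).mul_const M
    · refine Eventually.of_forall fun t ht => ?_
      have ht0 : 0 ≤ t := uIcc_nonneg zero_le_one hy (uIoc_subset_uIcc ht)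
      exact (slice_cont' h.cont (fun _ => ht0)).const_mul _

lemma ED.TH_cont (h : ED a M C0 u ux uy uxx uyy g) :
    ContinuousOn (fun p : ℝ × ℝ => TH a u uy p.1 p.2) CH := by
  rintro ⟨x0, y0⟩ hp
  have hy0 : 0 ≤ y0 := hp
  have ha := h.ha
  have h1 : Tendsto (fun p : ℝ × ℝ => TH a u uy p.1 p.2 - TH a u uy p.1 y0)
      (nhdsWithin (x0, y0) CH) (nhds 0) := by
    have hb : Tendsto (fun p : ℝ × ℝ => M / (1 + a) * |p.2 ^ (1 + a) - y0 ^ (1 + a)|)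
        (nhdsWithin (x0, y0) CH) (nhds 0) := by
      have hcont : Continuous (fun p : ℝ × ℝ => p.2 ^ (1 + a)) :=
        continuous_snd.rpow_const fun _ => Or.inr (by linarith)
      have hcont : Continuous (fun p : ℝ × ℝ => M / (1 + a) * |p.2 ^ (1 + a) - y0 ^ (1 + a)|) := by
        fun_prop
      have := hcont.tendsto (x0, y0)
      simp only [sub_self, abs_zero, mul_zero] at this
      exact this.mono_left nhdsWithin_le_nhds
    refine squeeze_zero_norm' ?_ hb
    filter_upwards [self_mem_nhdsWithin] with p hp'
    exact h.TH_mod p.1 hp' hy0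
  have h2 : Tendsto (fun p : ℝ × ℝ => TH a u uy p.1 y0)
      (nhdsWithin (x0, y0) CH) (nhds (TH a u uy x0 y0)) := by
    have : Continuous (fun p : ℝ × ℝ => TH a u uy p.1 y0) := (h.TH_contx hy0).comp continuous_fst
    exact (this.tendsto (x0, y0)).mono_left nhdsWithin_le_nhds
  have := h1.add h2
  simpa [ContinuousWithinAt] using this

lemma ED.TH_dy (h : ED a M C0 u ux uy uxx uyy g) (x y : ℝ) (hy : 0 < y) :
    HasDerivAt (fun r => TH a u uy x r) (-(y ^ a * u x y)) y := by
  have hc : ContinuousOn (fun t => t ^ a * u x t) (Ioi 0) := by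
    refine ContinuousOn.mul (fun t ht => (Real.continuousAt_rpow_const t a (Or.inl (ne_of_gt ht))).continuousWithinAt) ?_
    exact slice_cont h.cont (fun t ht => UH_sub ht)
  have := intervalIntegral.integral_hasDerivAt_right (h.intble x zero_le_one hy.le)
    (hc.stronglyMeasurableAtFilter isOpen_Ioi y hy) (hc.continuousAt (Ioi_mem_nhds hy))
  exact this.const_sub _

lemma param_deriv {q qx : ℝ → ℝ → ℝ} {B : ℝ → ℝ} {y : ℝ} (hy : 0 < y)
    (hq : ∀ x, ContinuousOn (fun t => q x t) (Ioi 0))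
    (hqx : ∀ x, ContinuousOn (fun t => qx x t) (Ioi 0)) (hB : ContinuousOn B (Ioi 0))
    (hd : ∀ x t, 0 < t → HasDerivAt (fun r => q r t) (qx x t) x)
    (hb : ∀ x t, 0 < t → |qx x t| ≤ B t) (x : ℝ) :
    HasDerivAt (fun r => ∫ t in (1:ℝ)..y, q r t) (∫ t in (1:ℝ)..y, qx x t) x := by
  have hpos : ∀ t ∈ uIcc 1 y, t ∈ Ioi (0:ℝ) := fun t ht => uIcc_pos one_pos hy ht
  refine (intervalIntegral.hasDerivAt_integral_of_dominated_loc_of_deriv_le (bound := B) (s := univ)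
    (F := q) (F' := qx) Filter.univ_mem ?_ ?_ ?_ ?_ ?_ ?_).2
  · exact Eventually.of_forall fun r =>
      ((hq r).mono hpos).intervalIntegrable.aestronglyMeasurable_restrict_uIoc
  · exact ((hq x).mono hpos).intervalIntegrable
  · exact ((hqx x).mono hpos).intervalIntegrable.aestronglyMeasurable_restrict_uIoc
  · exact Eventually.of_forall fun t ht r _ => hb r t (hpos t (uIoc_subset_uIcc ht))
  · exact (hB.mono hpos).intervalIntegrable
  · exact Eventually.of_forall fun t ht r _ => hd r t (hpos t (uIoc_subset_uIcc ht))

lemma rpow_contOn (a : ℝ) : ContinuousOn (fun t : ℝ => t ^ a) (Ioi 0) :=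
  fun t ht => (Real.continuousAt_rpow_const t a (Or.inl (ne_of_gt ht))).continuousWithinAt

/-- The x-derivative of `TH`. -/
noncomputable def THx (a : ℝ) (ux uy : ℝ → ℝ → ℝ) (x y : ℝ) : ℝ :=
  (∫ z' in (0:ℝ)..x, uy z' 1) - ∫ t in (1:ℝ)..y, t ^ a * ux x t

lemma ED.TH_dx (h : ED a M C0 u ux uy uxx uyy g) (x y : ℝ) (hy : 0 < y) :
    HasDerivAt (fun r => TH a u uy r y) (THx a ux uy x y) x := by
  obtain ⟨C, hC, he⟩ := h.est
  refine (h.prim x).fun_sub (param_deriv (q := fun x t => t ^ a * u x t)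
    (qx := fun x t => t ^ a * ux x t) (B := fun t => t ^ a * (C / t)) hy ?_ ?_ ?_ ?_ ?_ x)
  · exact fun x => (rpow_contOn a).mul (slice_cont h.cont (fun t ht => UH_sub ht))
  · exact fun x => (rpow_contOn a).mul (slice_cont h.cx (fun t ht => ht))
  · exact (rpow_contOn a).mul (continuousOn_const.div continuousOn_id fun t ht => ne_of_gt ht)
  · exact fun x t ht => (h.dx x t ht).const_mul _
  · intro x t ht
    rw [abs_mul, abs_of_pos (Real.rpow_pos_of_pos ht a)]
    exact mul_le_mul_of_nonneg_left (he x t ht).1 (Real.rpow_nonneg ht.le a)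

lemma ED.TH_dxx (h : ED a M C0 u ux uy uxx uyy g) (x y : ℝ) (hy : 0 < y) :
    HasDerivAt (fun r => THx a ux uy r y) (y ^ a * uy x y) x := by
  obtain ⟨C, hC, he⟩ := h.est
  have hcxx : ∀ x, ContinuousOn (fun t => t ^ a * uxx x t) (Ioi 0) :=
    fun x => (rpow_contOn a).mul (slice_cont h.cxx (fun t ht => ht))
  have := (h.prim2 x).fun_sub (param_deriv (q := fun x t => t ^ a * ux x t)
    (qx := fun x t => t ^ a * uxx x t) (B := fun t => t ^ a * (C / t ^ 2)) hy ?_ ?_ ?_ ?_ ?_ x)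
  · refine this.congr_deriv ?_
    have hpos : ∀ t ∈ uIcc 1 y, t ∈ Ioi (0:ℝ) := fun t ht => uIcc_pos one_pos hy ht
    have e := intervalIntegral.integral_eq_sub_of_hasDerivAt (a := 1) (b := y)
      (f := fun t => t ^ a * uy x t) (f' := fun t => -(t ^ a * uxx x t))
      (fun t ht => h.dw x t (hpos t ht)) ((hcxx x).neg.mono hpos).intervalIntegrable
    rw [intervalIntegral.integral_neg] at e
    simp only [Real.one_rpow, one_mul] at e
    linarith
  · exact fun x => (rpow_contOn a).mul (slice_cont h.cx (fun t ht => ht))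
  · exact hcxx
  · exact (rpow_contOn a).mul (continuousOn_const.div (continuousOn_id.pow 2) fun t ht => by
      have : (0:ℝ) < t := ht
      simp; exact this.ne')
  · exact fun x t ht => (h.dxx x t ht).const_mul _
  · intro x t ht
    rw [abs_mul, abs_of_pos (Real.rpow_pos_of_pos ht a)]
    exact mul_le_mul_of_nonneg_left (he x t ht).2.1 (Real.rpow_nonneg ht.le a)

lemma TH_neg (x y : ℝ) : TH a (fun x y => -u x y) (fun x y => -uy x y) x y = - TH a u uy x y := by
  simp [TH, intervalIntegral.integral_neg]
  ring

lemma ED.TH_psub (h : ED a M C0 u ux uy uxx uyy g) : PSub (-a) UH (TH a u uy) := by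
  refine ⟨THx a ux uy, fun x y => y ^ a * uy x y, fun x y => -(y ^ a * u x y),
    fun x y => -(a * y ^ (a - 1) * u x y + y ^ a * uy x y), fun x y hy => ?_⟩
  have hy : 0 < y := hy
  refine ⟨h.TH_dx x y hy, h.TH_dxx x y hy, h.TH_dy x y hy, ?_, ?_⟩
  · exact ((Real.hasDerivAt_rpow_const (p := a) (Or.inl hy.ne')).fun_mul (h.dy x y hy)).fun_neg
  · have e : y ^ a = y ^ (a - 1) * y := by
      rw [← Real.rpow_add_one hy.ne']; ring_nf
    apply le_of_eq
    dsimp only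
    rw [e]; ring

lemma ED.TH_psol (h : ED a M C0 u ux uy uxx uyy g) : PSol (-a) (TH a u uy) := by
  refine ⟨h.TH_psub, ?_⟩
  have := h.neg.TH_psub
  have e : TH a (fun x y => -u x y) (fun x y => -uy x y) = fun x y => - TH a u uy x y := by
    funext x y; exact TH_neg x y
  rwa [e] at this

/-- Auxiliary function for the boundary touching lemma. -/
noncomputable def ZZ (a : ℝ) (u uy : ℝ → ℝ → ℝ) (x y : ℝ) : ℝ :=
  y ^ (1 + a) * u x y + (1 + a) * TH a u uy x y

lemma ED.Z_dy (h : ED a M C0 u ux uy uxx uyy g) (x y : ℝ) (hy : 0 < y) :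
    HasDerivAt (fun r => ZZ a u uy x r) (y * (y ^ a * uy x y)) y := by
  have := ((Real.hasDerivAt_rpow_const (p := 1 + a) (Or.inl hy.ne')).fun_mul (h.dy x y hy)).fun_add
    ((h.TH_dy x y hy).const_mul (1 + a))
  refine this.congr_deriv ?_
  rw [show 1 + a - 1 = a by ring, add_comm 1 a, Real.rpow_add_one hy.ne']
  ring

lemma ED.Z_psub (h : ED a M C0 u ux uy uxx uyy g) : PSub (-(2 + a)) UH (ZZ a u uy) := by
  refine ⟨fun x y => y ^ (1 + a) * ux x y + (1 + a) * THx a ux uy x y,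
    fun x y => y ^ (1 + a) * uxx x y + (1 + a) * (y ^ a * uy x y),
    fun x y => y * (y ^ a * uy x y),
    fun x y => 1 * (y ^ a * uy x y) + y * (-(y ^ a * uxx x y)), fun x y hy => ?_⟩
  have hy : 0 < y := hy
  refine ⟨((h.dx x y hy).const_mul _).fun_add ((h.TH_dx x y hy).const_mul _),
    ((h.dxx x y hy).const_mul _).fun_add ((h.TH_dxx x y hy).const_mul _), h.Z_dy x y hy,
    (hasDerivAt_id y).fun_mul (h.dw x y hy), ?_⟩
  apply le_of_eq
  dsimp only
  rw [add_comm 1 a, Real.rpow_add_one hy.ne']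
  ring

lemma ED.Z_cont (h : ED a M C0 u ux uy uxx uyy g) :
    ContinuousOn (fun p : ℝ × ℝ => ZZ a u uy p.1 p.2) CH := by
  have ha := h.ha
  have hcont : Continuous (fun p : ℝ × ℝ => p.2 ^ (1 + a)) :=
    continuous_snd.rpow_const fun _ => Or.inr (by linarith)
  exact (hcont.continuousOn.mul h.cont).add (h.TH_cont.const_mul (1 + a))
end

open Real MeasureTheory Filter Set

section
variable {a M C0 : ℝ} {u ux uy uxx uyy : ℝ → ℝ → ℝ} {g : ℝ → ℝ}

lemma ZZ_zero (ha : -1 < a) (x : ℝ) : ZZ a u uy x 0 = (1 + a) * TH a u uy x 0 := by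
  unfold ZZ
  rw [Real.zero_rpow (by linarith)]; ring

lemma ED.touch (h : ED a M C0 u ux uy uxx uyy g) {x0 m κ ρ : ℝ} (hρ : 0 < ρ)
    (ht : ∀ x, |x - x0| ≤ ρ → TH a u uy x 0 ≤ TH a u uy x0 0 + m * (x - x0) + 1 / 2 * κ * (x - x0) ^ 2) :
    g x0 ≤ κ := by
  by_contra hcon
  push Not at hcon
  have ha := h.ha
  have ha1 := h.ha1
  have hA : (0:ℝ) < 1 + a := by linarith
  obtain ⟨c, hc1, hc2⟩ := exists_between hcon
  set φ : ℝ → ℝ → ℝ := fun x y => ZZ a u uy x y + (-(1 + a) * TH a u uy x0 0 + (-(1 + a) * m) * (x - x0)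
    + (-(1 + a) * κ / 2) * ((x - x0) ^ 2 - y ^ 2 / (1 + (-(2 + a))))) with hφ
  have hps : PSub (-(2 + a)) UH φ := h.Z_psub.add (psub_quad _ _ _ _ _ (by intro h0; linarith))
  have hcont : ContinuousOn (fun p : ℝ × ℝ => φ p.1 p.2) CH := by
    refine h.Z_cont.add ?_
    fun_prop
  obtain ⟨C, hC, hbox⟩ := box (b := -(2 + a)) (by linarith) (by linarith) (by intro h0; linarith)
  obtain ⟨B, hB0, hB⟩ : ∃ B : ℝ, 0 ≤ B ∧ ∀ x y, |x - x0| ≤ ρ → 0 ≤ y → y ≤ ρ → φ x y ≤ B := by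
    have hk : IsCompact (Icc (x0 - ρ) (x0 + ρ) ×ˢ Icc (0:ℝ) ρ) := isCompact_Icc.prod isCompact_Icc
    obtain ⟨B, hB⟩ := hk.bddAbove_image (hcont.mono (fun p hp => hp.2.1))
    refine ⟨max B 0, le_max_right _ _, fun x y hx h0 h1 => le_trans ?_ (le_max_left _ _)⟩
    refine hB ⟨(x, y), ⟨?_, h0, h1⟩, rfl⟩
    rw [abs_le] at hx
    constructor <;> linarith [hx.1, hx.2]
  have hbot : ∀ x, |x - x0| ≤ ρ → φ x 0 ≤ 0 := by
    intro x hx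
    have := mul_le_mul_of_nonneg_left (ht x hx) hA.le
    simp only [hφ, ZZ_zero ha]
    have e : (0:ℝ) ^ 2 / (1 + (-(2 + a))) = 0 := by simp
    rw [e]
    linarith
  have hup := hbox φ B x0 ρ hB0 hρ hps hcont hB hbot
  have hx0 : φ x0 0 = 0 := by
    simp only [hφ, ZZ_zero ha]; simp; ring
  -- derivative along the vertical line
  have hder : ∀ y, 0 < y → HasDerivAt (fun r => φ x0 r - 1 / 2 * (c - κ) * r ^ 2)
      (y * (y ^ a * uy x0 y) - c * y) y := by
    intro y hy
    have e : (fun r => φ x0 r - 1 / 2 * (c - κ) * r ^ 2) = fun r => ZZ a u uy x0 r +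
        (-(1 + a) * TH a u uy x0 0 - 1 / 2 * c * r ^ 2) := by
      funext r
      simp only [hφ]
      rw [show 1 + (-(2 + a)) = -(1 + a) by ring]
      field_simp
      ring
    rw [e]
    have := (h.Z_dy x0 y hy).fun_add ((((hasDerivAt_id y).fun_pow 2).const_mul (1 / 2 * c)).const_sub
      (-(1 + a) * TH a u uy x0 0))
    refine this.congr_deriv ?_
    simp; ring
  have hev : ∀ᶠ y in nhdsWithin (0:ℝ) (Ioi 0), c < y ^ a * uy x0 y :=
    (h.neu x0).eventually (lt_mem_nhds hc2)
  obtain ⟨δ, hδ, hδw⟩ := mem_nhdsGT_iff_exists_Ioo_subset.1 hev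
  have hδ0 : (0:ℝ) < δ := hδ
  have hmono : MonotoneOn (fun r => φ x0 r - 1 / 2 * (c - κ) * r ^ 2) (Ico 0 δ) := by
    refine monotoneOn_of_deriv_nonneg (convex_Ico 0 δ) ?_ ?_ ?_
    · refine ContinuousOn.sub (slice_cont hcont fun y hy => hy.1) (by fun_prop)
    · rw [interior_Ico]
      exact fun y hy => (hder y hy.1).differentiableAt.differentiableWithinAt
    · rw [interior_Ico]
      intro y hy
      rw [(hder y hy.1).deriv]
      have : c < y ^ a * uy x0 y := hδw hy
      nlinarith [hy.1]
  have hlow : ∀ y, 0 < y → y < δ → 1 / 2 * (c - κ) * y ^ 2 ≤ φ x0 y := by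
    intro y h0 h1
    have := hmono (left_mem_Ico.2 hδ0) ⟨h0.le, h1⟩ h0.le
    simp only [hx0] at this
    linarith
  have hlim : Tendsto (fun y : ℝ => B * C / ρ ^ (3 + a) * y ^ (1 + a)) (nhdsWithin 0 (Ioi 0)) (nhds 0) := by
    have h2 : Tendsto (fun y : ℝ => y ^ (1 + a)) (nhds 0) (nhds (0 ^ (1 + a))) :=
      (Real.continuous_rpow_const hA.le).tendsto 0
    rw [Real.zero_rpow hA.ne'] at h2
    have := h2.const_mul (B * C / ρ ^ (3 + a))
    rw [mul_zero] at this
    exact this.mono_left nhdsWithin_le_nhds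
  have : 1 / 2 * (c - κ) ≤ 0 := by
    refine ge_of_tendsto hlim ?_
    filter_upwards [Ioo_mem_nhdsGT hδ0, Ioo_mem_nhdsGT hρ] with y h1 h2
    have q1 := hlow y h1.1 h1.2
    have q2 := hup y h1.1.le h2.2.le
    have e : B * (C * (y / ρ) ^ (1 - -(2 + a))) = (B * C / ρ ^ (3 + a) * y ^ (1 + a)) * y ^ 2 := by
      rw [show 1 - -(2 + a) = 3 + a by ring, Real.div_rpow h1.1.le hρ.le,
        show 3 + a = (1 + a) + 2 by ring, Real.rpow_add h1.1, Real.rpow_two]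
      ring
    rw [e] at q2
    exact le_of_mul_le_mul_right (q1.trans q2) (by have := h1.1; positivity)
  linarith

lemma ED.sd_low (h : ED a M C0 u ux uy uxx uyy g) (x k : ℝ) :
    -(C0 * k ^ 2) ≤ TH a u uy (x + k) 0 + TH a u uy (x - k) 0 - 2 * TH a u uy x 0 := by
  wlog hk : 0 < k generalizing k
  · rcases eq_or_lt_of_le (not_lt.1 hk) with h0 | h0
    · subst h0; simp; linarith
    · have := this (-k) (by linarith)
      rw [← sub_eq_add_neg, sub_neg_eq_add] at this
      simp only [neg_sq] at this
      linarith
  by_contra hcon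
  push Not at hcon
  set θ : ℝ → ℝ := fun z => TH a u uy z 0 with hθ
  have hk2 : 0 < k ^ 2 := by positivity
  obtain ⟨C1, h1, h2⟩ : ∃ C1, C0 < C1 ∧ θ (x + k) + θ (x - k) - 2 * θ x < -(C1 * k ^ 2) := by
    have : C0 < -(θ (x + k) + θ (x - k) - 2 * θ x) / k ^ 2 := by
      rw [lt_div_iff₀ hk2]; simp only [hθ]; linarith
    obtain ⟨C1, h1, h2⟩ := exists_between this
    refine ⟨C1, h1, ?_⟩
    rw [lt_div_iff₀ hk2] at h2; linarith
  set m := (θ (x + k) - θ (x - k)) / (2 * k) with hm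
  set E : ℝ → ℝ := fun z => θ z + 1 / 2 * C1 * (z - x) ^ 2 - m * (z - x) with hE
  have hEc : Continuous E := by
    have : Continuous θ := h.TH_contx le_rfl
    fun_prop
  obtain ⟨z0, hz0, hmax⟩ := (isCompact_Icc (a := x - k) (b := x + k)).exists_isMaxOn
    ⟨x, by constructor <;> linarith⟩ hEc.continuousOn
  have hmk : m * k = (θ (x + k) - θ (x - k)) / 2 := by rw [hm]; field_simp
  have hxle : E x ≤ E z0 := hmax ⟨by linarith, by linarith⟩
  have hEx : E x = θ x := by simp [hE]
  have hEp : E (x + k) = θ (x + k) + 1 / 2 * C1 * k ^ 2 - m * k := by simp [hE]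
  have hEm : E (x - k) = θ (x - k) + 1 / 2 * C1 * k ^ 2 + m * k := by simp [hE]
  have hne1 : z0 ≠ x + k := by
    rintro rfl
    linarith
  have hne2 : z0 ≠ x - k := by
    rintro rfl
    linarith
  have hl : x - k < z0 := lt_of_le_of_ne hz0.1 hne2.symm
  have hr : z0 < x + k := lt_of_le_of_ne hz0.2 hne1
  have := h.touch (x0 := z0) (m := m - C1 * (z0 - x)) (κ := -C1) (ρ := min (z0 - (x - k)) (x + k - z0))
    (lt_min (by linarith) (by linarith)) ?_
  · have := abs_le.1 (h.gb z0)
    linarith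
  · intro z hz
    have hz1 := abs_le.1 (hz.trans (min_le_left _ _))
    have hz2 := abs_le.1 (hz.trans (min_le_right _ _))
    have : E z ≤ E z0 := hmax ⟨by linarith, by linarith⟩
    simp only [hE, hθ] at this
    nlinarith

lemma ED.sd_abs (h : ED a M C0 u ux uy uxx uyy g) (x k : ℝ) :
    |TH a u uy (x + k) 0 + TH a u uy (x - k) 0 - 2 * TH a u uy x 0| ≤ C0 * k ^ 2 := by
  rw [abs_le]
  refine ⟨h.sd_low x k, ?_⟩
  have := h.neg.sd_low x k
  simp only [TH_neg] at this
  linarith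

end

open Real MeasureTheory Filter Set

lemma sd_bound {φ φ' φ'' : ℝ → ℝ} {B : ℝ} (h1 : ∀ x, HasDerivAt φ (φ' x) x)
    (h2 : ∀ x, HasDerivAt φ' (φ'' x) x) (hB : ∀ x, |φ'' x| ≤ B) (x k : ℝ) :
    |φ (x + k) + φ (x - k) - 2 * φ x| ≤ B * k ^ 2 := by
  have l1 : ∀ p q, |φ' q - φ' p| ≤ B * |q - p| := fun p q =>
    Convex.norm_image_sub_le_of_norm_hasDerivWithin_le (f := φ') (f' := φ'') (s := univ)
      (fun z _ => (h2 z).hasDerivWithinAt) (fun z _ => hB z) convex_univ (mem_univ p) (mem_univ q)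
  have hd : ∀ z, HasDerivAt (fun t => φ (t + k) - φ t) (φ' (z + k) - φ' z) z := fun z => by
    have e1 := (hasDerivAt_id z).add_const k
    have c := HasDerivAt.comp z (h1 (z + k)) e1
    rw [mul_one] at c
    exact HasDerivAt.fun_sub c (h1 z)
  have := Convex.norm_image_sub_le_of_norm_hasDerivWithin_le (s := univ)
      (fun z _ => (hd z).hasDerivWithinAt) (C := B * |k|)
      (fun z _ => by simpa using l1 z (z + k)) convex_univ (mem_univ (x - k)) (mem_univ x)
  simp only [sub_add_cancel, sub_sub_cancel, Real.norm_eq_abs] at this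
  rw [mul_assoc, ← sq, sq_abs] at this
  convert this using 2
  ring

lemma sd_lim {φ φ' : ℝ → ℝ} {d x : ℝ} (h1 : ∀ x, HasDerivAt φ (φ' x) x)
    (h2 : HasDerivAt φ' d x) :
    Tendsto (fun k => (φ (x + k) + φ (x - k) - 2 * φ x) / k ^ 2) (nhdsWithin 0 (Ioi 0)) (nhds d) := by
  have hp : ∀ {ψ : ℝ → ℝ} {D k : ℝ}, HasDerivAt ψ D (x + k) → HasDerivAt (fun k => ψ (x + k)) D k := by
    intro ψ D k hψ
    have c := HasDerivAt.comp k hψ ((hasDerivAt_id k).const_add x)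
    rw [mul_one] at c
    exact c
  have hm : ∀ {ψ : ℝ → ℝ} {D k : ℝ}, HasDerivAt ψ D (x - k) → HasDerivAt (fun k => ψ (x - k)) (-D) k := by
    intro ψ D k hψ
    have c := HasDerivAt.comp k hψ ((hasDerivAt_id k).const_sub x)
    rw [mul_neg_one] at c
    exact c
  have hcont : Continuous φ := continuous_iff_continuousAt.2 fun z => (h1 z).continuousAt
  refine HasDerivAt.lhopital_zero_nhdsGT (f' := fun k => φ' (x + k) - φ' (x - k))
    (g' := fun k => 2 * k) ?_ ?_ ?_ ?_ ?_ ?_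
  · refine Eventually.of_forall fun k => ?_
    have := ((hp (h1 (x + k))).fun_add (hm (h1 (x - k)))).sub_const (2 * φ x)
    exact this
  · refine Eventually.of_forall fun k => ?_
    simpa using hasDerivAt_pow 2 k
  · filter_upwards [self_mem_nhdsWithin] with k hk
    have : (0:ℝ) < k := hk
    positivity
  · have : Continuous fun k => φ (x + k) + φ (x - k) - 2 * φ x := by fun_prop
    have := this.tendsto 0
    have e : φ (x + 0) + φ (x - 0) - 2 * φ x = 0 := by simp; ring
    rw [e] at this
    exact this.mono_left nhdsWithin_le_nhds
  · have : Continuous fun k : ℝ => k ^ 2 := by fun_prop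
    have := this.tendsto 0
    simp only [ne_eq, OfNat.ofNat_ne_zero, not_false_eq_true, zero_pow] at this
    exact this.mono_left nhdsWithin_le_nhds
  · have hd : HasDerivAt (fun k => φ' (x + k) - φ' (x - k)) (d - -d) 0 :=
      (hp (by simpa using h2)).fun_sub (hm (by simpa using h2))
    have := hasDerivAt_iff_tendsto_slope_zero.1 hd
    have := (this.const_mul (1 / 2)).mono_left (nhdsWithin_mono 0 (s := Ioi 0) (fun t ht => ne_of_gt ht))
    simp only [smul_eq_mul, zero_add, add_zero, sub_zero, sub_self] at this
    refine (this.congr fun t => ?_).trans ?_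
    · rw [div_eq_mul_inv (φ' (x + t) - φ' (x - t)), mul_inv]; ring
    · rw [show 1 / 2 * (d - -d) = d by ring]

lemma psub_const {b : ℝ} (hb : 1 + b ≠ 0) (A : ℝ) : PSub b UH (fun _ _ => A) := by
  simpa using psub_quad b A 0 0 0 hb

section
variable {a M C0 : ℝ} {u ux uy uxx uyy : ℝ → ℝ → ℝ} {g : ℝ → ℝ}

lemma ED.C00 (h : ED a M C0 u ux uy uxx uyy g) : 0 ≤ C0 := (abs_nonneg _).trans (h.gb 0)

/-- Second difference of `TH`. -/
noncomputable def SD (a : ℝ) (u uy : ℝ → ℝ → ℝ) (k x y : ℝ) : ℝ :=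
  TH a u uy (x + k) y + TH a u uy (x - k) y - 2 * TH a u uy x y

lemma ED.SD_psol (h : ED a M C0 u ux uy uxx uyy g) (k : ℝ) : PSol (-a) (SD a u uy k) := by
  have := ((h.TH_psol.trans k).add (h.TH_psol.trans (-k))).add (h.TH_psol.smul (-2))
  have e : SD a u uy k = fun x y => TH a u uy (x + k) y + TH a u uy (x + -k) y + -2 * TH a u uy x y := by
    funext x y; unfold SD; rw [← sub_eq_add_neg x k]; ring
  rw [e]; exact this

lemma ED.SD_cont (h : ED a M C0 u ux uy uxx uyy g) (k : ℝ) :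
    ContinuousOn (fun p : ℝ × ℝ => SD a u uy k p.1 p.2) CH := by
  have e : SD a u uy k = fun x y => TH a u uy (x + k) y + TH a u uy (x + -k) y - 2 * TH a u uy x y := by
    funext x y; unfold SD; rw [← sub_eq_add_neg x k]
  rw [e]
  have t : ∀ c : ℝ, ContinuousOn (fun p : ℝ × ℝ => TH a u uy (p.1 + c) p.2) CH := fun c => by
    have := ContinuousOn.comp (g := fun p : ℝ × ℝ => TH a u uy p.1 p.2)
      (f := fun p : ℝ × ℝ => (p.1 + c, p.2)) (s := CH) h.TH_cont (by fun_prop) (fun p hp => hp)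
    exact this
  exact ((t k).add (t (-k))).sub (h.TH_cont.const_mul 2)

lemma ED.SD_bdd (h : ED a M C0 u ux uy uxx uyy g) (k : ℝ) :
    ∃ B, ∀ x y, 0 ≤ y → |SD a u uy k x y| ≤ B := by
  obtain ⟨C, hC, he⟩ := h.est
  have ha := h.ha
  have ha1 := h.ha1
  have hM := h.M0
  have big : ∀ x y, 1 ≤ y → |SD a u uy k x y| ≤ C * k ^ 2 := by
    intro x y hy
    have hy0 : 0 < y := by linarith
    refine sd_bound (fun x => h.TH_dx x y hy0) (fun x => h.TH_dxx x y hy0) (fun z => ?_) x k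
    rw [abs_mul, abs_of_pos (Real.rpow_pos_of_pos hy0 a)]
    have h1 : y ^ a ≤ y := by
      simpa using Real.rpow_le_rpow_of_exponent_le hy ha1.le
    calc y ^ a * |uy z y| ≤ y * (C / y) := mul_le_mul h1 (he z y hy0).2.2.1 (abs_nonneg _) hy0.le
      _ = C := by field_simp
  refine ⟨C * k ^ 2 + 4 * (M / (1 + a)), fun x y hy => ?_⟩
  have hMa : 0 ≤ M / (1 + a) := div_nonneg hM (by linarith)
  rcases le_total 1 y with h1 | h1
  · have := big x y h1
    linarith
  · have b1 := big x 1 le_rfl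
    have t : ∀ z, |TH a u uy z y - TH a u uy z 1| ≤ M / (1 + a) := fun z => by
      refine (h.TH_mod z hy zero_le_one).trans ?_
      have : |y ^ (1 + a) - 1 ^ (1 + a)| ≤ 1 := by
        rw [Real.one_rpow, abs_le]
        have q1 := Real.rpow_nonneg hy (1 + a)
        have q2 := Real.rpow_le_one hy h1 (by linarith : 0 ≤ 1 + a)
        constructor <;> linarith
      nlinarith
    have t1 := abs_le.1 (t (x + k))
    have t2 := abs_le.1 (t (x - k))
    have t3 := abs_le.1 (t x)
    have b1 := abs_le.1 b1
    unfold SD at *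
    rw [abs_le]
    constructor <;> linarith [t1.1, t1.2, t2.1, t2.2, t3.1, t3.2, b1.1, b1.2]

lemma ED.SD_le (h : ED a M C0 u ux uy uxx uyy g) (k x y : ℝ) (hy : 0 ≤ y) :
    |SD a u uy k x y| ≤ C0 * k ^ 2 := by
  obtain ⟨B, hB⟩ := h.SD_bdd k
  have ha := h.ha
  have ha1 := h.ha1
  have hC0 : 0 ≤ C0 * k ^ 2 := mul_nonneg h.C00 (sq_nonneg _)
  have hc := psub_const (b := -a) (by linarith) (-(C0 * k ^ 2))
  have l1 := liouville (b := -a) (M := B) (by linarith) (by linarith) (by intro h0; linarith)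
    ((h.SD_psol k).1.add hc) ((h.SD_cont k).add continuousOn_const)
    (fun x y hy => by have := (abs_le.1 (hB x y hy)).2; linarith)
    (fun x => by have := (abs_le.1 (h.sd_abs x k)).2; unfold SD; linarith) x y hy
  have l2 := liouville (b := -a) (M := B) (by linarith) (by linarith) (by intro h0; linarith)
    ((h.SD_psol k).2.add hc) ((h.SD_cont k).neg.add continuousOn_const)
    (fun x y hy => by have := (abs_le.1 (hB x y hy)).1; linarith)
    (fun x => by have := (abs_le.1 (h.sd_abs x k)).1; unfold SD; linarith) x y hy
  rw [abs_le]; constructor <;> linarith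

lemma ED.SD_lim (h : ED a M C0 u ux uy uxx uyy g) (x y : ℝ) (hy : 0 < y) :
    Tendsto (fun k => SD a u uy k x y / k ^ 2) (nhdsWithin 0 (Ioi 0)) (nhds (y ^ a * uy x y)) := by
  unfold SD
  exact sd_lim (φ := fun x => TH a u uy x y) (φ' := fun x => THx a ux uy x y) (fun x => h.TH_dx x y hy) (h.TH_dxx x y hy)

lemma ED.w_le (h : ED a M C0 u ux uy uxx uyy g) (x y : ℝ) (hy : 0 < y) :
    |y ^ a * uy x y| ≤ C0 := by
  refine le_of_tendsto (h.SD_lim x y hy).abs ?_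
  filter_upwards [self_mem_nhdsWithin] with k hk
  have : (0:ℝ) < k := hk
  rw [abs_div, abs_of_pos (by positivity : 0 < k ^ 2), div_le_iff₀ (by positivity)]
  exact h.SD_le k x y hy.le

lemma ED.w_lip (h : ED a M C0 u ux uy uxx uyy g) (x x' y : ℝ) (hy : 0 < y) :
    |y ^ a * uy x' y - y ^ a * uy x y| ≤ 2 * (2 + |a|) * C0 / y * |x' - x| := by
  refine le_of_tendsto ((h.SD_lim x' y hy).sub (h.SD_lim x y hy)).abs ?_
  filter_upwards [self_mem_nhdsWithin] with k hk
  have hk : (0:ℝ) < k := hk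
  have := lip_bound (h.SD_psol k) ((h.SD_cont k).mono UH_sub) hy (M := C0 * k ^ 2)
    (fun x y h1 _ => h.SD_le k x y (by linarith)) x x'
  rw [← sub_div, abs_div, abs_of_pos (by positivity : 0 < k ^ 2), div_le_iff₀ (by positivity)]
  refine this.trans (le_of_eq ?_)
  rw [abs_neg]; ring

end

open Real MeasureTheory Filter Set

section
variable {a M C0 : ℝ} {u ux uy uxx uyy : ℝ → ℝ → ℝ} {g : ℝ → ℝ}

lemma ED.du_le (h : ED a M C0 u ux uy uxx uyy g) {q : ℝ} (hq : 0 < q) (hqa : a < q) (x x' y : ℝ)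
    (hy : 0 < y) (hy1 : y ≤ 1) :
    u x' y - u x y ≤ (2 * (2 + |a|) * M + 2 * (2 + |a|) * C0 / q) * y ^ (-q) * |x' - x| := by
  have hM := h.M0
  have hC0 := h.C00
  set L := 2 * (2 + |a|) * C0 * |x' - x| with hL
  have hL0 : 0 ≤ L := by have := abs_nonneg a; positivity
  have hd : ∀ t, 0 < t → HasDerivAt (fun t => u x' t - u x t - L / q * t ^ (-q))
      (uy x' t - uy x t - L / q * (-q * t ^ (-q - 1))) t := fun t ht =>
    ((h.dy x' t ht).fun_sub (h.dy x t ht)).fun_sub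
      ((Real.hasDerivAt_rpow_const (Or.inl ht.ne')).const_mul _)
  have hmono : MonotoneOn (fun t => u x' t - u x t - L / q * t ^ (-q)) (Icc y 1) := by
    refine monotoneOn_of_deriv_nonneg (convex_Icc y 1) ?_ ?_ ?_
    · exact fun t ht => (hd t (hy.trans_le ht.1)).continuousAt.continuousWithinAt
    · rw [interior_Icc]
      exact fun t ht => (hd t (hy.trans ht.1)).differentiableAt.differentiableWithinAt
    · rw [interior_Icc]
      intro t ht
      have ht0 : 0 < t := hy.trans ht.1
      rw [(hd t ht0).deriv]
      have e1 : L / q * (-q * t ^ (-q - 1)) = -(L * t ^ (-q - 1)) := by field_simp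
      rw [e1]
      have w := h.w_lip x x' t ht0
      have e2 : t ^ a * uy x' t - t ^ a * uy x t = t ^ a * (uy x' t - uy x t) := by ring
      rw [e2] at w
      have w := (abs_le.1 w).1
      have e3 : 2 * (2 + |a|) * C0 / t * |x' - x| = L / t := by rw [hL]; ring
      rw [e3] at w
      have hta := Real.rpow_pos_of_pos ht0 a
      have w2 : -(L * t ^ (-a - 1)) ≤ uy x' t - uy x t := by
        have e4 : t ^ a * t ^ (-a - 1) = 1 / t := by
          rw [← Real.rpow_add ht0, show a + (-a - 1) = -1 by ring, Real.rpow_neg_one, one_div]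
        have : t ^ a * (-(L * t ^ (-a - 1))) ≤ t ^ a * (uy x' t - uy x t) := by
          calc t ^ a * (-(L * t ^ (-a - 1))) = -(L * (t ^ a * t ^ (-a - 1))) := by ring
            _ = -(L / t) := by rw [e4]; ring
            _ ≤ _ := w
        exact le_of_mul_le_mul_left this hta
      have w3 : t ^ (-a - 1) ≤ t ^ (-q - 1) :=
        Real.rpow_le_rpow_of_exponent_ge ht0 ht.2.le (by linarith)
      nlinarith
  have := hmono (left_mem_Icc.2 hy1) (right_mem_Icc.2 hy1) hy1
  simp only [Real.one_rpow, mul_one] at this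
  have l := (abs_le.1 (h.lip x x' 1 one_pos)).2
  have hyq : 1 ≤ y ^ (-q) := Real.one_le_rpow_of_pos_of_le_one_of_nonpos hy hy1 (by linarith)
  have hLq : 0 ≤ L / q := by positivity
  have hN : 0 ≤ 2 * (2 + |a|) * M / 1 * |x' - x| := by have := abs_nonneg a; positivity
  calc u x' y - u x y ≤ 2 * (2 + |a|) * M / 1 * |x' - x| + L / q * y ^ (-q) := by linarith
    _ ≤ 2 * (2 + |a|) * M / 1 * |x' - x| * y ^ (-q) + L / q * y ^ (-q) := by nlinarith
    _ = _ := by rw [hL]; ring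

lemma ED.ux_small (h : ED a M C0 u ux uy uxx uyy g) {q : ℝ} (hq : 0 < q) (hqa : a < q) :
    ∃ K, 0 ≤ K ∧ ∀ x y, 0 < y → y ≤ 1 → |ux x y| ≤ K * y ^ (-q) := by
  have hM := h.M0
  have hC0 := h.C00
  have haa := abs_nonneg a
  refine ⟨2 * (2 + |a|) * M + 2 * (2 + |a|) * C0 / q, by positivity, fun x y hy hy1 => ?_⟩
  have hyq := Real.rpow_pos_of_pos hy (-q)
  have := norm_deriv_le_of_lip' (f := fun r => u r y) (x₀ := x)
    (C := (2 * (2 + |a|) * M + 2 * (2 + |a|) * C0 / q) * y ^ (-q)) (by positivity) ?_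
  · rwa [(h.dx x y hy).deriv] at this
  · refine Eventually.of_forall fun x' => ?_
    rw [Real.norm_eq_abs, Real.norm_eq_abs, abs_le]
    have h1 := h.du_le hq hqa x x' y hy hy1
    have h2 := h.du_le hq hqa x' x y hy hy1
    rw [abs_sub_comm x x'] at h2
    constructor <;> linarith

lemma ED.dom (h : ED a M C0 u ux uy uxx uyy g) :
    ∃ B : ℝ → ℝ, IntegrableOn B (Ioi 0) ∧
      ∀ x t, 0 < t → t ^ a * (ux x t ^ 2 + uy x t ^ 2) ≤ B t := by
  have ha := h.ha
  have ha1 := h.ha1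
  obtain ⟨q, hq, hqa, hq2⟩ : ∃ q : ℝ, 0 < q ∧ a < q ∧ 2 * q < 1 + a := by
    rcases le_total 0 a with h0 | h0
    · exact ⟨(1 + 3 * a) / 4, by linarith, by linarith, by linarith⟩
    · exact ⟨(1 + a) / 4, by linarith, by linarith, by linarith⟩
  obtain ⟨C, hC, he⟩ := h.est
  obtain ⟨K, hK, hk⟩ := h.ux_small hq hqa
  have i1 : IntegrableOn (fun t : ℝ => K ^ 2 * t ^ (a - 2 * q) + C0 ^ 2 * t ^ (-a)) (Ioc 0 1) := by
    have r : ∀ p : ℝ, -1 < p → IntegrableOn (fun t : ℝ => t ^ p) (Ioc 0 1) := fun p hp =>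
      (intervalIntegrable_iff_integrableOn_Ioc_of_le zero_le_one).1
        (intervalIntegral.intervalIntegrable_rpow' hp)
    exact ((r _ (by linarith)).const_mul _).add ((r _ (by linarith)).const_mul _)
  have i2 : IntegrableOn (fun t : ℝ => 2 * C ^ 2 * t ^ (a - 2)) (Ioi 1) :=
    (integrableOn_Ioi_rpow_of_lt (by linarith) one_pos).const_mul _
  refine ⟨fun t => (Ioc (0:ℝ) 1).indicator (fun t : ℝ => K ^ 2 * t ^ (a - 2 * q) + C0 ^ 2 * t ^ (-a)) t
    + (Ioi (1:ℝ)).indicator (fun t : ℝ => 2 * C ^ 2 * t ^ (a - 2)) t,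
    ((i1.integrable_indicator measurableSet_Ioc).add
      (i2.integrable_indicator measurableSet_Ioi)).integrableOn, fun x t ht => ?_⟩
  have hta := Real.rpow_pos_of_pos ht a
  beta_reduce
  rcases le_or_gt t 1 with h1 | h1
  · rw [indicator_of_mem (show t ∈ Ioc (0:ℝ) 1 from ⟨ht, h1⟩),
      indicator_of_notMem (show t ∉ Ioi (1:ℝ) from not_lt.2 h1), add_zero, mul_add]
    refine add_le_add ?_ ?_
    · have := hk x t ht h1
      have : ux x t ^ 2 ≤ (K * t ^ (-q)) ^ 2 := sq_le_sq' (abs_le.1 this).1 (abs_le.1 this).2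
      calc t ^ a * ux x t ^ 2 ≤ t ^ a * (K * t ^ (-q)) ^ 2 := mul_le_mul_of_nonneg_left this hta.le
        _ = K ^ 2 * (t ^ a * t ^ (-q) * t ^ (-q)) := by ring
        _ = _ := by rw [← Real.rpow_add ht, ← Real.rpow_add ht]; ring_nf
    · have := h.w_le x t ht
      have : (t ^ a * uy x t) ^ 2 ≤ C0 ^ 2 := sq_le_sq' (abs_le.1 this).1 (abs_le.1 this).2
      have e : t ^ a * t ^ (-a) = 1 := by rw [← Real.rpow_add ht]; simp
      have hta' := Real.rpow_pos_of_pos ht (-a)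
      calc t ^ a * uy x t ^ 2 = (t ^ a * t ^ (-a)) * (t ^ a * uy x t ^ 2) := by rw [e]; ring
        _ = (t ^ a * uy x t) ^ 2 * t ^ (-a) := by ring
        _ ≤ _ := mul_le_mul_of_nonneg_right this hta'.le
  · rw [indicator_of_notMem (show t ∉ Ioc (0:ℝ) 1 from fun hh => not_lt.2 hh.2 h1),
      indicator_of_mem (show t ∈ Ioi (1:ℝ) from h1), zero_add]
    have s1 := (he x t ht).1
    have s2 := (he x t ht).2.2.1
    have s1 : ux x t ^ 2 ≤ (C / t) ^ 2 := sq_le_sq' (abs_le.1 s1).1 (abs_le.1 s1).2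
    have s2 : uy x t ^ 2 ≤ (C / t) ^ 2 := sq_le_sq' (abs_le.1 s2).1 (abs_le.1 s2).2
    calc t ^ a * (ux x t ^ 2 + uy x t ^ 2) ≤ t ^ a * ((C / t) ^ 2 + (C / t) ^ 2) :=
          mul_le_mul_of_nonneg_left (add_le_add s1 s2) hta.le
      _ = _ := by
        rw [Real.rpow_sub ht, Real.rpow_two]; ring

lemma ED.slx (h : ED a M C0 u ux uy uxx uyy g) (x : ℝ) : ContinuousOn (fun t => ux x t) (Ioi 0) :=
  slice_cont h.cx (fun _ ht => ht)

lemma ED.sly (h : ED a M C0 u ux uy uxx uyy g) (x : ℝ) : ContinuousOn (fun t => uy x t) (Ioi 0) :=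
  slice_cont h.cy (fun _ ht => ht)

lemma ED.intE (h : ED a M C0 u ux uy uxx uyy g) (x : ℝ) :
    IntegrableOn (fun t => t ^ a * (ux x t ^ 2 + uy x t ^ 2)) (Ioi 0) := by
  obtain ⟨B, hB, hb⟩ := h.dom
  refine Integrable.mono' hB ?_ ?_
  · exact ((rpow_contOn a).mul (((h.slx x).pow 2).add ((h.sly x).pow 2))).aestronglyMeasurable
      measurableSet_Ioi
  · filter_upwards [ae_restrict_mem measurableSet_Ioi] with t ht
    have ht : (0:ℝ) < t := ht
    rw [Real.norm_eq_abs, abs_of_nonneg (by positivity)]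
    exact hb x t ht

lemma ED.Hbound (a p q t : ℝ) (ht : 0 < t) :
    ‖1 / 2 * t ^ a * (p ^ 2 - q ^ 2)‖ ≤ t ^ a * (p ^ 2 + q ^ 2) := by
  have hta := Real.rpow_pos_of_pos ht a
  rw [Real.norm_eq_abs, abs_mul, abs_of_pos (by positivity)]
  have : |p ^ 2 - q ^ 2| ≤ p ^ 2 + q ^ 2 := by
    rw [abs_le]; constructor <;> nlinarith [sq_nonneg p, sq_nonneg q]
  have h2 : 0 ≤ t ^ a * (p ^ 2 + q ^ 2) := by positivity
  nlinarith

lemma ED.meaH (h : ED a M C0 u ux uy uxx uyy g) (x : ℝ) :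
    ContinuousOn (fun t => 1 / 2 * t ^ a * (ux x t ^ 2 - uy x t ^ 2)) (Ioi 0) :=
  ((continuousOn_const.mul (rpow_contOn a))).mul (((h.slx x).pow 2).sub ((h.sly x).pow 2))

lemma ED.intH (h : ED a M C0 u ux uy uxx uyy g) (x : ℝ) :
    IntegrableOn (fun t => 1 / 2 * t ^ a * (ux x t ^ 2 - uy x t ^ 2)) (Ioi 0) := by
  refine Integrable.mono' (h.intE x) ((h.meaH x).aestronglyMeasurable measurableSet_Ioi) ?_
  filter_upwards [ae_restrict_mem measurableSet_Ioi] with t ht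
  exact ED.Hbound a _ _ t ht

end

open Real MeasureTheory Filter Set

section
variable {a M C0 : ℝ} {u ux uy uxx uyy uxy : ℝ → ℝ → ℝ} {g : ℝ → ℝ}

lemma ED.rect (h : ED a M C0 u ux uy uxx uyy g)
    (m1 : ∀ x y, 0 < y → HasDerivAt (fun r => ux x r) (uxy x y) y)
    (m2 : ∀ x y, 0 < y → HasDerivAt (fun r => uy r y) (uxy x y) x)
    (cxy : ContinuousOn (fun p : ℝ × ℝ => uxy p.1 p.2) UH) (x1 x2 : ℝ) {ε R : ℝ} (hε : 0 < ε)
    (hR : 0 < R) :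
    (∫ t in ε..R, 1 / 2 * t ^ a * (ux x2 t ^ 2 - uy x2 t ^ 2)) -
      ∫ t in ε..R, 1 / 2 * t ^ a * (ux x1 t ^ 2 - uy x1 t ^ 2) =
    ∫ x in x1..x2, (ux x ε * (ε ^ a * uy x ε) - ux x R * (R ^ a * uy x R)) := by
  have hpos : ∀ t ∈ uIcc ε R, t ∈ Ioi (0:ℝ) := fun t ht => uIcc_pos hε hR ht
  have hsub : ∀ x, IntervalIntegrable (fun t => 1 / 2 * t ^ a * (ux x t ^ 2 - uy x t ^ 2)) volume ε R :=
    fun x => ((h.meaH x).mono hpos).intervalIntegrable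
  rw [← intervalIntegral.integral_sub (hsub x2) (hsub x1)]
  have hrc : ContinuousOn (fun p : ℝ × ℝ => p.2 ^ a) UH :=
    ContinuousOn.comp (g := fun t : ℝ => t ^ a) (rpow_contOn a) continuous_snd.continuousOn
      (fun p hp => hp)
  have hFc : ContinuousOn (fun p : ℝ × ℝ => p.2 ^ a * (ux p.1 p.2 * uxx p.1 p.2 - uy p.1 p.2 * uxy p.1 p.2)) UH :=
    hrc.mul ((h.cx.mul h.cxx).sub (h.cy.mul cxy))
  have s1 : ∀ t ∈ uIcc ε R, 1 / 2 * t ^ a * (ux x2 t ^ 2 - uy x2 t ^ 2) - 1 / 2 * t ^ a * (ux x1 t ^ 2 - uy x1 t ^ 2)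
      = ∫ x in x1..x2, t ^ a * (ux x t * uxx x t - uy x t * uxy x t) := by
    intro t ht
    have ht0 : 0 < t := hpos t ht
    have := intervalIntegral.integral_eq_sub_of_hasDerivAt (a := x1) (b := x2)
      (f := fun x => 1 / 2 * t ^ a * (ux x t ^ 2 - uy x t ^ 2))
      (f' := fun x => t ^ a * (ux x t * uxx x t - uy x t * uxy x t)) (fun x _ => ?_) ?_
    · rw [this]
    · have := (((h.dxx x t ht0).fun_pow 2).fun_sub ((m2 x t ht0).fun_pow 2)).const_mul (1 / 2 * t ^ a)
      refine this.congr_deriv ?_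
      simp; ring
    · exact (slice_cont' (φ := fun x t => t ^ a * (ux x t * uxx x t - uy x t * uxy x t)) hFc
        (fun x => ht0)).intervalIntegrable _ _
  rw [intervalIntegral.integral_congr s1]
  rw [intervalIntegral_intervalIntegral_swap]
  · refine intervalIntegral.integral_congr fun x _ => ?_
    have := intervalIntegral.integral_eq_sub_of_hasDerivAt (a := ε) (b := R)
      (f := fun t => -(ux x t * (t ^ a * uy x t)))
      (f' := fun t => t ^ a * (ux x t * uxx x t - uy x t * uxy x t)) (fun t ht => ?_) ?_
    · beta_reduce
      rw [this]; ring
    · have := ((m1 x t (hpos t ht)).fun_mul (h.dw x t (hpos t ht))).fun_neg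
      refine this.congr_deriv ?_
      ring
    · exact ((slice_cont (φ := fun x t => t ^ a * (ux x t * uxx x t - uy x t * uxy x t)) (x := x) hFc
        (T := Ioi 0) (fun t ht => ht)).mono hpos).intervalIntegrable
  · have hk : IsCompact (uIcc ε R ×ˢ uIcc x1 x2) := isCompact_uIcc.prod isCompact_uIcc
    have hc : ContinuousOn (Function.uncurry fun t x => t ^ a * (ux x t * uxx x t - uy x t * uxy x t))
        (uIcc ε R ×ˢ uIcc x1 x2) := by
      have := ContinuousOn.comp (f := fun p : ℝ × ℝ => (p.2, p.1)) (s := uIcc ε R ×ˢ uIcc x1 x2) hFc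
        (by fun_prop) (fun p hp => hpos p.1 hp.1)
      exact this
    exact (hc.integrableOn_compact hk).mono_set (prod_mono uIoc_subset_uIcc uIoc_subset_uIcc)

lemma ED.ham (h : ED a M C0 u ux uy uxx uyy g)
    (m1 : ∀ x y, 0 < y → HasDerivAt (fun r => ux x r) (uxy x y) y)
    (m2 : ∀ x y, 0 < y → HasDerivAt (fun r => uy r y) (uxy x y) x)
    (cxy : ContinuousOn (fun p : ℝ × ℝ => uxy p.1 p.2) UH)
    (ccx : ContinuousOn (fun p : ℝ × ℝ => ux p.1 p.2) CH) (x1 x2 : ℝ) :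
    (∫ t in Ioi (0:ℝ), 1 / 2 * t ^ a * (ux x2 t ^ 2 - uy x2 t ^ 2)) -
      (∫ t in Ioi (0:ℝ), 1 / 2 * t ^ a * (ux x1 t ^ 2 - uy x1 t ^ 2)) =
    ∫ x in x1..x2, ux x 0 * g x := by
  have ha1 := h.ha1
  set e : ℕ → ℝ := fun n => 1 / ((n:ℝ) + 1) with he
  set R : ℕ → ℝ := fun n => (n:ℝ) + 1 with hRdef
  have he0 : ∀ n, 0 < e n := fun n => by simp only [he]; positivity
  have hR0 : ∀ n, 0 < R n := fun n => by simp only [hRdef]; positivity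
  have hR1 : ∀ n, 1 ≤ R n := fun n => by simp only [hRdef]; linarith [n.cast_nonneg (α := ℝ)]
  have he1 : ∀ n, e n ≤ 1 := fun n => by
    simp only [he]; rw [div_le_one (hR0 n)]; exact hR1 n
  have hel : Tendsto e atTop (nhds 0) := tendsto_one_div_add_atTop_nhds_zero_nat
  have hRl : Tendsto R atTop atTop := tendsto_atTop_add_const_right _ _ tendsto_natCast_atTop_atTop
  have hel' : Tendsto e atTop (nhdsWithin 0 (Ioi 0)) :=
    tendsto_nhdsWithin_iff.2 ⟨hel, Eventually.of_forall he0⟩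
  have hL : ∀ x, Tendsto (fun n => ∫ t in e n..R n, 1 / 2 * t ^ a * (ux x t ^ 2 - uy x t ^ 2)) atTop
      (nhds (∫ t in Ioi (0:ℝ), 1 / 2 * t ^ a * (ux x t ^ 2 - uy x t ^ 2))) := by
    intro x
    have hcov : AECover (volume.restrict (Ioi (0:ℝ))) atTop (fun n => Ioi (e n) ∩ Iic (R n)) :=
      (aecover_Ioi_of_Ioi hel).inter (aecover_Iic hRl)
    refine (hcov.integral_tendsto_of_countably_generated (h.intH x)).congr fun n => ?_
    rw [intervalIntegral.integral_of_le ((he1 n).trans (hR1 n)), Measure.restrict_restrict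
      (measurableSet_Ioi.inter measurableSet_Iic)]
    congr 2
    ext t
    constructor
    · rintro ⟨⟨h1, h2⟩, h3⟩; exact ⟨h1, h2⟩
    · rintro ⟨h1, h2⟩; exact ⟨⟨h1, h2⟩, (he0 n).trans h1⟩
  obtain ⟨C, hC, hest⟩ := h.est
  obtain ⟨K, hK⟩ : ∃ K, ∀ x ∈ uIcc x1 x2, ∀ t ∈ Icc (0:ℝ) 1, |ux x t| ≤ K := by
    have hk : IsCompact (uIcc x1 x2 ×ˢ Icc (0:ℝ) 1) := isCompact_uIcc.prod isCompact_Icc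
    obtain ⟨K, hK⟩ := hk.exists_bound_of_continuousOn (ccx.mono (fun p hp => hp.2.1))
    exact ⟨K, fun x hx t ht => hK (x, t) ⟨hx, ht⟩⟩
  have hC0 := h.C00
  have hRb : ∀ x n, |ux x (R n) * (R n ^ a * uy x (R n))| ≤ C ^ 2 / R n := by
    intro x n
    have h1 := (hest x (R n) (hR0 n)).1
    have h2 := (hest x (R n) (hR0 n)).2.2.1
    have h3 : R n ^ a ≤ R n := by simpa using Real.rpow_le_rpow_of_exponent_le (hR1 n) ha1.le
    have hp := hR0 n
    rw [abs_mul, abs_mul, abs_of_pos (Real.rpow_pos_of_pos hp a)]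
    calc |ux x (R n)| * (R n ^ a * |uy x (R n)|) ≤ C / R n * (R n * (C / R n)) := by
          gcongr
      _ = C ^ 2 / R n := by field_simp
  have hD : Tendsto (fun n => ∫ x in x1..x2, (ux x (e n) * (e n ^ a * uy x (e n)) -
      ux x (R n) * (R n ^ a * uy x (R n)))) atTop (nhds (∫ x in x1..x2, ux x 0 * g x)) := by
    refine intervalIntegral.tendsto_integral_filter_of_dominated_convergence
      (fun _ => K * C0 + C ^ 2) ?_ ?_ ?_ ?_
    · refine Eventually.of_forall fun n => ?_
      have c : ∀ t, 0 < t → Continuous fun x => ux x t * (t ^ a * uy x t) := fun t ht =>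
        (slice_cont' h.cx (fun x => ht)).mul ((slice_cont' h.cy (fun x => ht)).const_mul _)
      exact ((c _ (he0 n)).sub (c _ (hR0 n))).aestronglyMeasurable
    · refine Eventually.of_forall fun n => Eventually.of_forall fun x hx => ?_
      have hx' := uIoc_subset_uIcc hx
      refine (norm_sub_le _ _).trans (add_le_add ?_ ?_)
      · rw [norm_mul, Real.norm_eq_abs, Real.norm_eq_abs]
        have k1 := hK x hx' (e n) ⟨(he0 n).le, he1 n⟩
        exact mul_le_mul k1 (h.w_le x _ (he0 n)) (abs_nonneg _) ((abs_nonneg _).trans k1)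
      · refine (hRb x n).trans ?_
        exact div_le_self (sq_nonneg C) (hR1 n)
    · exact intervalIntegrable_const
    · refine Eventually.of_forall fun x hx => ?_
      have l1 : Tendsto (fun n => ux x (e n)) atTop (nhds (ux x 0)) := by
        have hc : ContinuousOn (fun t => ux x t) (Ici 0) := slice_cont ccx (fun t ht => ht)
        have := hc 0 self_mem_Ici
        exact Tendsto.comp this (tendsto_nhdsWithin_iff.2
          ⟨hel, Eventually.of_forall fun n => (he0 n).le⟩)
      have l2 : Tendsto (fun n => e n ^ a * uy x (e n)) atTop (nhds (g x)) := (h.neu x).comp hel'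
      have l3 : Tendsto (fun n => ux x (R n) * (R n ^ a * uy x (R n))) atTop (nhds 0) :=
        squeeze_zero_norm (hRb x) (tendsto_const_nhds.div_atTop hRl)
      simpa using (l1.mul l2).sub l3
  refine tendsto_nhds_unique (((hL x2).sub (hL x1)).congr fun n => ?_) hD
  exact h.rect m1 m2 cxy x1 x2 (he0 n) (hR0 n)

end

open Real MeasureTheory Filter Set

lemma interp {φ φ' φ'' : ℝ → ℝ} {p η B : ℝ} (hη : 0 < η)
    (h1 : ∀ z ∈ Icc p (p + η), HasDerivAt φ (φ' z) z)
    (h2 : ∀ z ∈ Icc p (p + η), HasDerivAt φ' (φ'' z) z)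
    (hB : ∀ z ∈ Icc p (p + η), |φ'' z| ≤ B) :
    |φ' p| ≤ |φ (p + η) - φ p| / η + B * η := by
  have hp : p ∈ Icc p (p + η) := ⟨le_rfl, by linarith⟩
  have hpe : p + η ∈ Icc p (p + η) := ⟨by linarith, le_rfl⟩
  have hB0 : 0 ≤ B := (abs_nonneg _).trans (hB p hp)
  have l1 : ∀ z ∈ Icc p (p + η), |φ' z - φ' p| ≤ B * η := fun z hz => by
    have := Convex.norm_image_sub_le_of_norm_hasDerivWithin_le (s := Icc p (p + η))
      (fun z hz => (h2 z hz).hasDerivWithinAt) (fun z hz => hB z hz) (convex_Icc _ _) hp hz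
    refine this.trans (mul_le_mul_of_nonneg_left ?_ hB0)
    rw [Real.norm_eq_abs, abs_of_nonneg] <;> linarith [hz.1, hz.2]
  have hd : ∀ z ∈ Icc p (p + η), HasDerivAt (fun t => φ t - φ' p * t) (φ' z - φ' p) z := fun z hz => by
    simpa using (h1 z hz).fun_sub ((hasDerivAt_id z).const_mul (φ' p))
  have := Convex.norm_image_sub_le_of_norm_hasDerivWithin_le (s := Icc p (p + η))
      (fun z hz => (hd z hz).hasDerivWithinAt) l1 (convex_Icc _ _) hp hpe
  rw [Real.norm_eq_abs, Real.norm_eq_abs, add_sub_cancel_left, abs_of_pos hη] at this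
  have e : φ (p + η) - φ' p * (p + η) - (φ p - φ' p * p) = (φ (p + η) - φ p) - φ' p * η := by ring
  rw [e] at this
  have t : |φ' p * η| ≤ |φ (p + η) - φ p| + B * η * η := by
    have := abs_sub_abs_le_abs_sub (φ' p * η) (φ (p + η) - φ p)
    rw [abs_sub_comm (φ' p * η)] at this
    linarith
  rw [abs_mul, abs_of_pos hη] at t
  rw [div_add' _ _ _ hη.ne', le_div_iff₀ hη]
  exact t

lemma lim_of_interp {F : ℝ → ℝ} {B η0 : ℝ} (hη0 : 0 < η0) (D : ℝ → ℝ → ℝ)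
    (hD : ∀ η, 0 < η → Tendsto (D η) atTop (nhds 0))
    (hF : ∀ η, 0 < η → η ≤ η0 → ∀ x, |F x| ≤ D η x / η + B * η) : Tendsto F atTop (nhds 0) := by
  rw [Metric.tendsto_nhds]
  intro ε hε
  set η := min η0 (ε / (2 * (|B| + 1))) with hηd
  have hB := abs_nonneg B
  have hη : 0 < η := lt_min hη0 (by positivity)
  have hle : B * η ≤ ε / 2 := by
    calc B * η ≤ (|B| + 1) * (ε / (2 * (|B| + 1))) :=
          mul_le_mul (by linarith [le_abs_self B]) (min_le_right _ _) hη.le (by positivity)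
      _ = ε / 2 := by field_simp
  have : ∀ᶠ x in atTop, D η x < ε / 2 * η := (hD η hη).eventually (gt_mem_nhds (by positivity))
  filter_upwards [this] with x hx
  rw [Real.dist_eq, sub_zero]
  have := hF η hη (min_le_left _ _) x
  have h3 : D η x / η < ε / 2 := by rwa [div_lt_iff₀ hη]
  linarith

section
variable {a M C0 : ℝ} {u ux uy uxx uyy : ℝ → ℝ → ℝ} {g : ℝ → ℝ}

lemma ED.lim_u (h : ED a M C0 u ux uy uxx uyy g) (hl : Tendsto (fun x => u x 0) atTop (nhds 1))
    {y : ℝ} (hy : 0 ≤ y) : Tendsto (fun x => u x y) atTop (nhds 1) := by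
  have ha := h.ha
  have ha1 := h.ha1
  have hM := h.M0
  obtain ⟨C, hC, hbox⟩ := box (b := a) (by linarith) ha1 (by intro h0; linarith)
  rw [Metric.tendsto_nhds]
  intro ε hε
  have hlim : Tendsto (fun ρ : ℝ => (M + 1) * (C * (y / ρ) ^ (1 - a))) atTop (nhds 0) := by
    have h1 : Tendsto (fun ρ : ℝ => y / ρ) atTop (nhds 0) := tendsto_const_nhds.div_atTop tendsto_id
    have h2 := h1.rpow_const (p := 1 - a) (Or.inr (by linarith))
    rw [Real.zero_rpow (by linarith)] at h2
    simpa using (h2.const_mul C).const_mul (M + 1)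
  obtain ⟨ρ, hρ1, hρ0, hρy⟩ := ((hlim.eventually (gt_mem_nhds (half_pos hε))).and
    ((eventually_gt_atTop 0).and (eventually_ge_atTop y))).exists
  obtain ⟨X, hX⟩ := eventually_atTop.1 (Metric.tendsto_nhds.1 hl (ε / 2) (half_pos hε))
  filter_upwards [eventually_ge_atTop (X + ρ)] with x hx
  have hbot : ∀ z, |z - x| ≤ ρ → |u z 0 - 1| < ε / 2 := fun z hz => by
    have := (abs_le.1 hz).1
    have := hX z (by linarith)
    rwa [Real.dist_eq] at this
  have hcst : ∀ A : ℝ, PSub a UH (fun _ _ => A) := fun A => psub_const (by linarith) A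
  have p1 := hbox (fun x y => u x y + (-1 - ε / 2)) (M + 1) x ρ (by linarith) hρ0
    (h.psub.add (hcst _)) (h.cont.add continuousOn_const)
    (fun z t _ ht _ => by have := (abs_le.1 (h.bdd z t ht)).2; linarith)
    (fun z hz => by have := (abs_lt.1 (hbot z hz)).2; linarith) y hy hρy
  have p2 := hbox (fun x y => -u x y + (1 - ε / 2)) (M + 1) x ρ (by linarith) hρ0
    (h.neg.psub.add (hcst _)) (h.cont.neg.add continuousOn_const)
    (fun z t _ ht _ => by have := (abs_le.1 (h.bdd z t ht)).1; linarith)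
    (fun z hz => by have := (abs_lt.1 (hbot z hz)).1; linarith) y hy hρy
  rw [Real.dist_eq, abs_lt]
  constructor <;> linarith

lemma ED.lim_ux (h : ED a M C0 u ux uy uxx uyy g) (hl : Tendsto (fun x => u x 0) atTop (nhds 1))
    {y : ℝ} (hy : 0 < y) : Tendsto (fun x => ux x y) atTop (nhds 0) := by
  obtain ⟨C, hC, he⟩ := h.est
  refine lim_of_interp (B := C / y ^ 2) one_pos (fun η x => |u (x + η) y - u x y|) ?_ ?_
  · intro η _
    have l := h.lim_u hl hy.le
    have l2 : Tendsto (fun x => u (x + η) y) atTop (nhds 1) :=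
      l.comp (tendsto_atTop_add_const_right _ _ tendsto_id)
    simpa using (l2.sub l).abs
  · intro η hη _ x
    exact interp (φ := fun x => u x y) (φ' := fun x => ux x y) hη (fun z _ => h.dx z y hy)
      (fun z _ => h.dxx z y hy) (fun z _ => (he z y hy).2.1)

lemma ED.lim_uy (h : ED a M C0 u ux uy uxx uyy g) (hl : Tendsto (fun x => u x 0) atTop (nhds 1))
    {y : ℝ} (hy : 0 < y) : Tendsto (fun x => uy x y) atTop (nhds 0) := by
  obtain ⟨C, hC, he⟩ := h.est
  refine lim_of_interp (B := C / y ^ 2) one_pos (fun η x => |u x (y + η) - u x y|) ?_ ?_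
  · intro η hη
    have l := h.lim_u hl hy.le
    have l2 := h.lim_u hl (by linarith : 0 ≤ y + η)
    simpa using (l2.sub l).abs
  · intro η hη _ x
    have hp : ∀ z ∈ Icc y (y + η), 0 < z := fun z hz => hy.trans_le hz.1
    refine interp (φ := fun t => u x t) (φ' := fun t => uy x t) hη (fun z hz => h.dy x z (hp z hz))
      (fun z hz => h.dyy x z (hp z hz)) (fun z hz => (he x z (hp z hz)).2.2.2.trans ?_)
    have := hz.1
    gcongr

lemma ED.lim_H (h : ED a M C0 u ux uy uxx uyy g) (hl : Tendsto (fun x => u x 0) atTop (nhds 1)) :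
    Tendsto (fun x => ∫ t in Ioi (0:ℝ), 1 / 2 * t ^ a * (ux x t ^ 2 - uy x t ^ 2)) atTop (nhds 0) := by
  obtain ⟨B, hB, hb⟩ := h.dom
  have := tendsto_integral_filter_of_dominated_convergence (μ := volume.restrict (Ioi (0:ℝ)))
    (l := atTop) (F := fun x t => 1 / 2 * t ^ a * (ux x t ^ 2 - uy x t ^ 2)) (f := fun _ => (0:ℝ)) B
    (Eventually.of_forall fun x => (h.intH x).aestronglyMeasurable) ?_ hB ?_
  · simpa using this
  · refine Eventually.of_forall fun x => ?_
    filter_upwards [ae_restrict_mem measurableSet_Ioi] with t ht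
    exact (ED.Hbound a _ _ t ht).trans (hb x t ht)
  · filter_upwards [ae_restrict_mem measurableSet_Ioi] with t ht
    have := (((h.lim_ux hl ht).pow 2).sub ((h.lim_uy hl ht).pow 2)).const_mul (1 / 2 * t ^ a)
    simpa using this

end

open Real MeasureTheory Filter Set

lemma isOpen_UH : IsOpen UH := isOpen_lt continuous_const continuous_snd

lemma pd_x {Φ : ℝ × ℝ → ℝ} {x y : ℝ} {L : ℝ × ℝ →L[ℝ] ℝ} (h : HasFDerivAt Φ L (x, y)) :
    HasDerivAt (fun r => Φ (r, y)) (L (1, 0)) x := by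
  have : HasDerivAt (fun r : ℝ => (r, y)) ((1:ℝ), (0:ℝ)) x :=
    (hasDerivAt_id x).prodMk (hasDerivAt_const x y)
  exact h.comp_hasDerivAt x this

lemma pd_y {Φ : ℝ × ℝ → ℝ} {x y : ℝ} {L : ℝ × ℝ →L[ℝ] ℝ} (h : HasFDerivAt Φ L (x, y)) :
    HasDerivAt (fun r => Φ (x, r)) (L (0, 1)) y := by
  have : HasDerivAt (fun r : ℝ => (x, r)) ((0:ℝ), (1:ℝ)) y :=
    (hasDerivAt_const y x).prodMk (hasDerivAt_id y)
  exact h.comp_hasDerivAt y this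

theorem build {a : ℝ} {f : ℝ → ℝ} {u : ℝ → ℝ → ℝ} (ha : -1 < a) (ha1 : a < 1) (hf : Continuous f)
    (hu : IsBoundedExtSolution1 a f u) : ∃ M C0 : ℝ, ∃ uxx uyy uxy : ℝ → ℝ → ℝ,
    ED a M C0 u (fun x y => deriv (fun x' => u x' y) x) (fun x y => deriv (fun t' => u x t') y)
      uxx uyy (fun x => -f (u x 0) / (1 + a)) ∧
    (∀ x y, 0 < y → HasDerivAt (fun r => deriv (fun x' => u x' r) x) (uxy x y) y) ∧
    (∀ x y, 0 < y → HasDerivAt (fun r => deriv (fun t' => u r t') y) (uxy x y) x) ∧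
    ContinuousOn (fun p : ℝ × ℝ => uxy p.1 p.2) UH := by
  obtain ⟨M, hM⟩ := hu.bounded
  have hA : 0 < 1 + a := by linarith
  obtain ⟨K, hK⟩ := (isCompact_Icc (a := -M) (b := M)).exists_bound_of_continuousOn hf.continuousOn
  set F : ℝ × ℝ → ℝ := fun p => u p.1 p.2 with hF
  have hsm : ∀ p ∈ UH, ContDiffAt ℝ 2 F p := fun p hp => hu.smooth.contDiffAt (isOpen_UH.mem_nhds hp)
  have hd1 : ∀ p ∈ UH, HasFDerivAt F (fderiv ℝ F p) p := fun p hp =>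
    ((hsm p hp).differentiableAt (by norm_num)).hasFDerivAt
  have hsm1 : ∀ p ∈ UH, ContDiffAt ℝ 1 (fderiv ℝ F) p := fun p hp =>
    (hsm p hp).fderiv_right (by norm_num)
  have hd2 : ∀ p ∈ UH, HasFDerivAt (fderiv ℝ F) (fderiv ℝ (fderiv ℝ F) p) p := fun p hp =>
    ((hsm1 p hp).differentiableAt (by norm_num)).hasFDerivAt
  have hc2 : ∀ p ∈ UH, ContinuousAt (fderiv ℝ (fderiv ℝ F)) p := fun p hp =>
    ((hsm1 p hp).fderiv_right (m := 0) (by norm_num)).continuousAt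
  have hdv : ∀ v, ∀ p ∈ UH, HasFDerivAt (fun p => fderiv ℝ F p v) ((fderiv ℝ (fderiv ℝ F) p).flip v) p :=
    fun v p hp => by
      have := (hd2 p hp).clm_apply (hasFDerivAt_const v p)
      simpa using this
  have ex : ∀ x y, 0 < y → deriv (fun x' => u x' y) x = fderiv ℝ F (x, y) (1, 0) := fun x y hy =>
    (pd_x (hd1 (x, y) hy)).deriv
  have ey : ∀ x y, 0 < y → deriv (fun t' => u x t') y = fderiv ℝ F (x, y) (0, 1) := fun x y hy =>
    (pd_y (hd1 (x, y) hy)).deriv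
  have symm : ∀ p ∈ UH, ∀ v w, fderiv ℝ (fderiv ℝ F) p v w = fderiv ℝ (fderiv ℝ F) p w v := fun p hp v w =>
    (hsm p hp).isSymmSndFDerivAt (by simp) v w
  have cvv : ∀ v w, ContinuousOn (fun p : ℝ × ℝ => fderiv ℝ (fderiv ℝ F) p v w) UH := fun v w p hp =>
    (((hc2 p hp).clm_apply continuousAt_const).clm_apply continuousAt_const).continuousWithinAt
  have cv : ∀ v, ContinuousOn (fun p : ℝ × ℝ => fderiv ℝ F p v) UH := fun v p hp =>
    (hdv v p hp).continuousAt.continuousWithinAt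
  have dxx : ∀ x y, 0 < y → HasDerivAt (fun r => deriv (fun x' => u x' y) r)
      (fderiv ℝ (fderiv ℝ F) (x, y) (1, 0) (1, 0)) x := fun x y hy => by
    have := pd_x (hdv (1, 0) (x, y) hy)
    have e : (fun r => deriv (fun x' => u x' y) r) = fun r => fderiv ℝ F (r, y) (1, 0) :=
      funext fun r => ex r y hy
    rw [e]; exact this
  have dyy : ∀ x y, 0 < y → HasDerivAt (fun r => deriv (fun t' => u x t') r)
      (fderiv ℝ (fderiv ℝ F) (x, y) (0, 1) (0, 1)) y := fun x y hy => by
    have := pd_y (hdv (0, 1) (x, y) hy)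
    refine HasDerivAt.congr_of_eventuallyEq this ?_
    filter_upwards [Ioi_mem_nhds hy] with r hr
    exact ey x r hr
  refine ⟨M, K / (1 + a), fun x y => fderiv ℝ (fderiv ℝ F) (x, y) (1, 0) (1, 0),
    fun x y => fderiv ℝ (fderiv ℝ F) (x, y) (0, 1) (0, 1),
    fun x y => fderiv ℝ (fderiv ℝ F) (x, y) (0, 1) (1, 0), ?_, ?_, ?_, ?_⟩
  · refine ⟨ha, ha1, hM, hu.cont, ?_, dxx, ?_, dyy, hu.contDx.mono UH_sub, ?_, cvv _ _, ?_, ?_, ?_⟩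
    · intro x y hy
      rw [ex x y hy]; exact pd_x (hd1 (x, y) hy)
    · intro x y hy
      rw [ey x y hy]; exact pd_y (hd1 (x, y) hy)
    · exact (cv (0, 1)).congr fun p hp => ey p.1 p.2 hp
    · intro x y hy
      have := hu.eqn x y hy
      rw [(dxx x y hy).deriv, (dyy x y hy).deriv] at this
      exact this
    · intro x
      have := (hu.neumann x).const_mul (-1 / (1 + a))
      refine (this.congr fun y => ?_).trans (le_of_eq ?_)
      · field_simp
      · congr 1; ring
    · intro x
      rw [abs_div, abs_neg, abs_of_pos hA]
      exact div_le_div_of_nonneg_right (hK _ (abs_le.1 (hM x 0 le_rfl))) hA.le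
  · intro x y hy
    have := pd_y (hdv (1, 0) (x, y) hy)
    refine HasDerivAt.congr_of_eventuallyEq this ?_
    filter_upwards [Ioi_mem_nhds hy] with r hr
    exact ex x r hr
  · intro x y hy
    have := pd_x (hdv (0, 1) (x, y) hy)
    have e : (fun r => deriv (fun t' => u r t') y) = fun r => fderiv ℝ F (r, y) (0, 1) :=
      funext fun r => ey r y hy
    rw [e]
    refine this.congr_deriv ?_
    exact symm (x, y) hy _ _
  · exact cvv _ _


open Real MeasureTheory Filter Set

/-- The Hamiltonian equality for layer solutions of the extension problem. -/
theorem statement16 (s γ a : ℝ) (hs : s ∈ Set.Ioo (0:ℝ) 1) (ha : a = 1 - 2*s)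
    (hγ : max 0 (1 - 2*s) < γ)
    (f : ℝ → ℝ) (hf : IsC1Holder γ f)
    (u : ℝ → ℝ → ℝ) (hu : IsLayerExtSolution1 a f u) :
    ∀ x : ℝ,
      IntegrableOn (fun t : ℝ => t ^ a *
          ((deriv (fun x' => u x' t) x) ^ 2 + (deriv (fun t' => u x t') t) ^ 2))
        (Set.Ioi 0) ∧
      (1+a) * ∫ t in Set.Ioi (0:ℝ), (1/2) * t ^ a *
          ((deriv (fun x' => u x' t) x) ^ 2 - (deriv (fun t' => u x t') t) ^ 2)
        = potG f (u x 0) - potG f 1 := by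
  have ha0 : -1 < a := by rw [ha]; linarith [hs.2]
  have ha1 : a < 1 := by rw [ha]; linarith [hs.1]
  have hA : 1 + a ≠ 0 := by linarith
  have hfc : Continuous f := hf.1.continuous
  obtain ⟨M, C0, uxx, uyy, uxy, h, m1, m2, cxy⟩ := build ha0 ha1 hfc hu.toIsBoundedExtSolution1
  have hmain : ∀ x1 x2 : ℝ,
      (1 + a) * (∫ t in Ioi (0:ℝ), 1 / 2 * t ^ a * ((deriv (fun x' => u x' t) x2) ^ 2 -
        (deriv (fun t' => u x2 t') t) ^ 2)) -
      (1 + a) * (∫ t in Ioi (0:ℝ), 1 / 2 * t ^ a * ((deriv (fun x' => u x' t) x1) ^ 2 -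
        (deriv (fun t' => u x1 t') t) ^ 2)) = potG f (u x2 0) - potG f (u x1 0) := by
    intro x1 x2
    have hh := h.ham m1 m2 cxy hu.contDx x1 x2
    rw [← mul_sub, hh]
    have hd0 : ∀ x, HasDerivAt (fun r => u r 0) (deriv (fun x' => u x' 0) x) x := fun x =>
      (differentiableAt_of_deriv_ne_zero (hu.mono x).ne').hasDerivAt
    have hc0 : Continuous fun x => deriv (fun x' => u x' 0) x :=
      slice_cont' (φ := fun x y => deriv (fun x' => u x' y) x) hu.contDx
        (fun x => le_refl (0:ℝ))
    have cv := intervalIntegral.integral_comp_mul_deriv (a := x1) (b := x2) (f := fun r => u r 0)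
      (f' := fun x => deriv (fun x' => u x' 0) x) (g := f) (fun x _ => hd0 x) hc0.continuousOn hfc
    have e : (1 + a) * (∫ x in x1..x2, deriv (fun x' => u x' 0) x * (-f (u x 0) / (1 + a))) =
        -∫ x in x1..x2, (f ∘ fun r => u r 0) x * deriv (fun x' => u x' 0) x := by
      rw [← intervalIntegral.integral_const_mul, ← intervalIntegral.integral_neg]
      refine intervalIntegral.integral_congr fun x _ => ?_
      simp only [Function.comp]
      field_simp
    rw [e, cv]
    unfold potG
    have := intervalIntegral.integral_interval_sub_left (hfc.intervalIntegrable (μ := volume) 0 (u x2 0))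
      (hfc.intervalIntegrable (μ := volume) 0 (u x1 0))
    rw [← this]; ring
  intro x
  refine ⟨h.intE x, ?_⟩
  have hGc : Continuous (potG f) :=
    (intervalIntegral.continuous_primitive (fun _ _ => hfc.intervalIntegrable _ _) 0).neg
  have l1 := ((h.lim_H hu.limPos).const_mul (1 + a)).sub_const
    ((1 + a) * (∫ t in Ioi (0:ℝ), 1 / 2 * t ^ a * ((deriv (fun x' => u x' t) x) ^ 2 -
        (deriv (fun t' => u x t') t) ^ 2)))
  have l2 : Tendsto (fun x2 => potG f (u x2 0) - potG f (u x 0)) atTop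
      (nhds (potG f 1 - potG f (u x 0))) :=
    ((hGc.tendsto 1).comp hu.limPos).sub_const _
  have := tendsto_nhds_unique (l1.congr fun x2 => hmain x x2) l2
  linarith
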